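/- arXiv:1405.0630 — 2 statements merged into one kernel-verified Lean document; each statement's English description precedes it below -/
import Mathlib

section
/- Let k be a field of characteristic zero, K = k(t), and let γ, c ∈ k[t] with φ(x) = (x−γ)² + c. If φ is stable, post-critically infinite, and h(φ) > 0, then the arboreal Galois representation has finite index; concretely, there exists a constant C ≥ 1 such that for every n ≥ 1, 2^(2^n − 1) ≤ C · [K_n : K], where [K_n : K] is the degree of the splitting field of φ^n over K. -/
open Polynomial

/-- A relation `dp · q = 2 p · dq` forces `deg p = 2 deg q`. -/
theorem natDegree_eq_two_mul_of_derivative_mul {F : Type*} [Field F] [CharZero F] {p q : F[X]}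
    (hp : p ≠ 0) (hq : q ≠ 0)
    (h : derivative p * q = 2 * p * derivative q) : p.natDegree = 2 * q.natDegree := by
  have key : ∀ u v : F[X], (X * (derivative u * v)).coeff (u.natDegree + v.natDegree)
      = u.natDegree * u.leadingCoeff * v.leadingCoeff := by
    intro u v
    have : (X * derivative u).natDegree ≤ u.natDegree := by
      rcases Nat.eq_zero_or_pos u.natDegree with h0 | h0
      · rw [natDegree_eq_zero.1 h0 |>.choose_spec.symm]; simp
      · refine natDegree_mul_le.trans ?_
        have := natDegree_derivative_lt h0.ne'
        rw [natDegree_X]; omega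
    rw [← mul_assoc, coeff_mul_add_eq_of_natDegree_le this le_rfl]
    rcases Nat.eq_zero_or_pos u.natDegree with h0 | h0
    · simp [h0]
    · obtain ⟨m, hm⟩ := Nat.exists_eq_succ_of_ne_zero h0.ne'
      rw [leadingCoeff, leadingCoeff, hm, Nat.succ_eq_add_one, coeff_X_mul, coeff_derivative]
      push_cast; ring
  have h2 : (X * (derivative p * q)) = C 2 * (X * (derivative q * p)) := by
    rw [h, map_ofNat]; ring
  have h3 := congrArg (fun r : F[X] => r.coeff (p.natDegree + q.natDegree)) h2
  simp only [coeff_C_mul] at h3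
  rw [key, add_comm p.natDegree, key] at h3
  have hl := mul_ne_zero (leadingCoeff_ne_zero.2 hp) (leadingCoeff_ne_zero.2 hq)
  have : ((p.natDegree : F) - 2 * q.natDegree) * (p.leadingCoeff * q.leadingCoeff) = 0 := by
    linear_combination h3
  have := (mul_eq_zero.1 this).resolve_right hl
  exact_mod_cast sub_eq_zero.1 this

theorem natDegree_derivative_le_natDegree {F : Type*} [Field F] (p : F[X]) :
    (derivative p).natDegree ≤ p.natDegree :=
  (natDegree_derivative_le p).trans (Nat.sub_le _ _)

theorem not_dvd_mul_derivative_sq_add {F : Type*} [Field F] [CharZero F] {g s Q : F[X]}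
    (hs : s ≠ 0) (hQ : Q ≠ 0) (hg : Q.natDegree + 2 * s.natDegree < g.natDegree)
    (h : g ^ 2 + s ∣ Q * derivative (g ^ 2 + s)) : False := by
  have hg0 : g ≠ 0 := by rintro rfl; simp at hg
  set Y := 2 * s * derivative g - derivative s * g with hY
  have hd : derivative (g ^ 2 + s) = 2 * g * derivative g + derivative s := by
    rw [derivative_add, derivative_sq, map_ofNat]
  have h1 : g ^ 2 + s ∣ Q * s * Y := by
    rw [hd] at h
    have e : Q * s * Y = (g ^ 2 + s) * (Q * Y + Q * g * derivative s)
        - s * g * (Q * (2 * g * derivative g + derivative s)) := by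
      rw [hY]; ring
    rw [e]
    exact dvd_sub (dvd_mul_right _ _) (h.mul_left _)
  have hdeg : (g ^ 2 + s).natDegree = 2 * g.natDegree := by
    rw [natDegree_add_eq_left_of_natDegree_lt, natDegree_pow]
    rw [natDegree_pow]; omega
  have hYd : Y.natDegree ≤ s.natDegree + g.natDegree := by
    have := natDegree_derivative_le_natDegree s
    have := natDegree_derivative_le_natDegree g
    refine (natDegree_sub_le _ _).trans (max_le ?_ ?_)
    · rw [mul_assoc]
      refine (natDegree_mul_le (p := (2 : F[X]))).trans ?_
      have := natDegree_mul_le (p := s) (q := derivative g)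
      rw [natDegree_ofNat]; omega
    · have := natDegree_mul_le (p := derivative s) (q := g)
      omega
  have h0 : Q * s * Y = 0 := by
    by_contra hne
    have := natDegree_le_of_dvd h1 hne
    have h2 := natDegree_mul_le (p := Q * s) (q := Y)
    have h3 := natDegree_mul_le (p := Q) (q := s)
    omega
  have hY0 := (mul_eq_zero.1 h0).resolve_left (mul_ne_zero hQ hs)
  have := natDegree_eq_two_mul_of_derivative_mul hs hg0 (by rw [← sub_eq_zero.1 hY0])
  omega

theorem sq_add_ne_mul_sq {F : Type*} [Field F] [CharZero F] {s c d y g : F[X]}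
    (hs : s ≠ 0) (hc : c ≠ 0) (hsc : s ^ 2 + c ≠ 0) {H D : ℕ}
    (hsH : s.natDegree ≤ H) (hcH : c.natDegree ≤ H) (hdD : d.natDegree ≤ D)
    (hg : 10 * H + 2 * D < g.natDegree) :
    ((g ^ 2 + s) ^ 2 + s) ^ 2 + c ≠ d * y ^ 2 := by
  intro h
  set e := g ^ 2 + s with he
  set a := e ^ 2 + s with ha
  have hde : e.natDegree = 2 * g.natDegree := by
    rw [he, natDegree_add_eq_left_of_natDegree_lt, natDegree_pow]
    rw [natDegree_pow]; omega
  have hda : a.natDegree = 4 * g.natDegree := by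
    rw [ha, natDegree_add_eq_left_of_natDegree_lt, natDegree_pow, hde]
    · omega
    rw [natDegree_pow]; omega
  have hdac : (a ^ 2 + c).natDegree = 8 * g.natDegree := by
    rw [natDegree_add_eq_left_of_natDegree_lt, natDegree_pow, hda]
    · omega
    rw [natDegree_pow]; omega
  have ha0 : a ≠ 0 := by rintro h0; simp [h0] at hda; omega
  have he0 : e ≠ 0 := by rintro h0; simp [h0] at hde; omega
  have hdy : d * y ^ 2 ≠ 0 := by
    rw [← h]; rintro h0; simp [h0] at hdac; omega
  have hd0 : d ≠ 0 := left_ne_zero_of_mul hdy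
  have hy0 : y ≠ 0 := by rintro rfl; simp at hdy
  have hdegy : 8 * g.natDegree = d.natDegree + 2 * y.natDegree := by
    rw [← hdac, h, natDegree_mul hd0 (pow_ne_zero _ hy0), natDegree_pow]
  have hder : 2 * a * derivative a + derivative c
      = y * (derivative d * y + 2 * d * derivative y) := by
    have := congrArg derivative h
    rw [derivative_add, derivative_sq, map_ofNat, derivative_mul, derivative_sq, map_ofNat] at this
    rw [this]; ring
  set Z := derivative c * a - 2 * c * derivative a with hZ
  obtain ⟨z, hz⟩ : y ∣ c * Z := by
    refine ⟨(d * y) * (Z - a * derivative c) + a * c * (derivative d * y + 2 * d * derivative y), ?_⟩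
    linear_combination (Z - a * derivative c) * h  + a * c * hder + (-a^2) * hZ
  have hZ0 : Z ≠ 0 := by
    intro h0
    have := natDegree_eq_two_mul_of_derivative_mul hc ha0 (by rw [← sub_eq_zero.1 h0])
    omega
  have hz0 : z ≠ 0 := by
    rintro rfl
    exact mul_ne_zero hc hZ0 (by rw [hz, mul_zero])
  have hdc := natDegree_derivative_le_natDegree c
  have hds := natDegree_derivative_le_natDegree s
  have hda' := natDegree_derivative_le_natDegree a
  have hZd : Z.natDegree ≤ H + a.natDegree := by
    refine (natDegree_sub_le _ _).trans (max_le ?_ ?_)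
    · have := natDegree_mul_le (p := derivative c) (q := a)
      omega
    · rw [mul_assoc]
      refine (natDegree_mul_le (p := (2 : F[X]))).trans ?_
      have := natDegree_mul_le (p := c) (q := derivative a)
      rw [natDegree_ofNat]; omega
  have hzd : 2 * z.natDegree ≤ 4 * H + D := by
    have h1 := congrArg natDegree hz
    rw [natDegree_mul hy0 hz0, natDegree_mul hc hZ0] at h1
    omega
  set E := derivative c * e - 4 * c * derivative e with hE
  set w := derivative c * s - 2 * c * derivative s with hw
  have hwd : w.natDegree ≤ 2 * H := by
    refine (natDegree_sub_le _ _).trans (max_le ?_ ?_)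
    · have := natDegree_mul_le (p := derivative c) (q := s)
      omega
    · rw [mul_assoc]
      refine (natDegree_mul_le (p := (2 : F[X]))).trans ?_
      have := natDegree_mul_le (p := c) (q := derivative s)
      rw [natDegree_ofNat]; omega
  have hZE : Z = E * e + w := by
    rw [hZ, hE, hw, ha, derivative_add, derivative_sq, map_ofNat]; ring
  have hsq : d * c ^ 2 * (E * e + w) ^ 2 = z ^ 2 * ((e ^ 2 + s) ^ 2 + c) := by
    rw [← hZE, ← ha, h]
    linear_combination d * (c * Z + y * z) * hz
  have hconst : d * c ^ 2 * w ^ 2 = z ^ 2 * (s ^ 2 + c) := by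
    have hdvd : e ∣ d * c ^ 2 * w ^ 2 - z ^ 2 * (s ^ 2 + c) :=
      ⟨z ^ 2 * (e ^ 3 + 2 * e * s) - d * c ^ 2 * (E ^ 2 * e + 2 * E * w), by
        linear_combination hsq⟩
    by_contra hne
    have h1 := natDegree_le_of_dvd hdvd (sub_ne_zero.2 hne)
    have h2 := natDegree_sub_le (d * c ^ 2 * w ^ 2) (z ^ 2 * (s ^ 2 + c))
    have h3 := natDegree_mul_le (p := d * c ^ 2) (q := w ^ 2)
    have h4 := natDegree_mul_le (p := d) (q := c ^ 2)
    have h5 := natDegree_mul_le (p := z ^ 2) (q := s ^ 2 + c)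
    have h6 := natDegree_add_le (s ^ 2) c
    rw [natDegree_pow] at h3 h4 h5 h6
    have h7 : max (2 * s.natDegree) c.natDegree ≤ 2 * H := max_le (by omega) (by omega)
    have h8 : max (d * c ^ 2 * w ^ 2).natDegree (z ^ 2 * (s ^ 2 + c)).natDegree
        ≤ 10 * H + 2 * D := by
      refine max_le ?_ ?_ <;> omega
    omega
  have hw0 : w ≠ 0 := by
    intro h0
    rw [h0] at hconst
    exact mul_ne_zero (pow_ne_zero 2 hz0) hsc (by rw [← hconst]; ring)
  refine not_dvd_mul_derivative_sq_add (g := g) (s := s) (Q := C 8 * (d * c ^ 3 * w)) hs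
    (by simp [hd0, hc, hw0]) ?_ ?_
  · rw [natDegree_C_mul (by norm_num)]
    have h1 := natDegree_mul_le (p := d * c ^ 3) (q := w)
    have h2 := natDegree_mul_le (p := d) (q := c ^ 3)
    rw [natDegree_pow] at h2
    omega
  · rw [← he, map_ofNat]
    have h1 : e * (d * c ^ 2 * (E ^ 2 * e + 2 * E * w)) = e * (z ^ 2 * (e ^ 3 + 2 * s * e)) := by
      linear_combination hsq - hconst
    have h2 := mul_left_cancel₀ he0 h1
    refine ⟨2 * d * c ^ 2 * w * derivative c + d * c ^ 2 * E ^ 2 - z ^ 2 * (e ^ 2 + 2 * s), ?_⟩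
    linear_combination (2 * d * c ^ 2 * w) * hE - h2

section QuadraticTower

open IntermediateField

variable {K Ω : Type*} [Field K] [Field Ω] [Algebra K Ω]

theorem mem_sup_adjoin_sqrt {L : IntermediateField K Ω} {r : Ω} (hr : r ^ 2 ∈ L) {x : Ω}
    (hx : x ∈ L ⊔ adjoin K {r}) : ∃ u ∈ L, ∃ v ∈ L, x = u + v * r := by
  rw [← restrictScalars_adjoin_eq_sup, mem_restrictScalars] at hx
  have hint : IsIntegral L r :=
    IsIntegral.of_pow (n := 2) two_pos (isIntegral_algebraMap (x := (⟨r ^ 2, hr⟩ : L)))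
  rw [← mem_toSubalgebra, adjoin_simple_toSubalgebra_of_isAlgebraic hint.isAlgebraic] at hx
  induction hx using Algebra.adjoin_induction with
  | mem x hx =>
    rw [Set.mem_singleton_iff] at hx
    exact ⟨0, zero_mem _, 1, one_mem _, by simp [hx]⟩
  | algebraMap l => exact ⟨l, l.2, 0, zero_mem _, by simp⟩
  | add x y _ _ hx hy =>
    obtain ⟨u, hu, v, hv, rfl⟩ := hx
    obtain ⟨u', hu', v', hv', rfl⟩ := hy
    exact ⟨u + u', add_mem hu hu', v + v', add_mem hv hv', by ring⟩
  | mul x y _ _ hx hy =>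
    obtain ⟨u, hu, v, hv, rfl⟩ := hx
    obtain ⟨u', hu', v', hv', rfl⟩ := hy
    exact ⟨u * u' + v * v' * r ^ 2, add_mem (mul_mem hu hu') (mul_mem (mul_mem hv hv') hr),
      u * v' + v * u', add_mem (mul_mem hu hv') (mul_mem hv hu'), by ring⟩

theorem finrank_sup_adjoin_sqrt {L : IntermediateField K Ω} {r : Ω} (hr : r ^ 2 ∈ L)
    (hrL : r ∉ L) : Module.finrank K ↥(L ⊔ adjoin K {r}) = 2 * Module.finrank K L := by
  have hint : IsIntegral L r :=
    IsIntegral.of_pow (n := 2) two_pos (isIntegral_algebraMap (x := (⟨r ^ 2, hr⟩ : L)))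
  have h2 : Module.finrank L (adjoin L {r}) = 2 := by
    rw [adjoin.finrank hint]
    refine le_antisymm ?_ ?_
    · have h0 : (X ^ 2 - C (⟨r ^ 2, hr⟩ : L)).Monic := monic_X_pow_sub_C _ two_ne_zero
      have := natDegree_le_of_dvd (minpoly.dvd L r (p := X ^ 2 - C ⟨r ^ 2, hr⟩)
        (by simp [IntermediateField.algebraMap_apply])) h0.ne_zero
      rwa [natDegree_X_pow_sub_C] at this
    · rw [minpoly.two_le_natDegree_iff hint]
      rintro ⟨l, rfl⟩
      exact hrL l.2
  rw [← restrictScalars_adjoin_eq_sup, mul_comm, ← h2]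
  exact (Module.finrank_mul_finrank K L (adjoin L {r})).symm

theorem exists_finrank_sup_adjoin_sqrts (T : Finset Ω) : ∀ (L : IntermediateField K Ω),
    (∀ r ∈ T, r ^ 2 ∈ L) →
    ∃ m, Module.finrank K ↥(L ⊔ adjoin K (T : Set Ω)) = 2 ^ m * Module.finrank K L := by
  classical
  induction T using Finset.induction_on with
  | empty => intro L _; exact ⟨0, by rw [Finset.coe_empty, adjoin_empty, sup_bot_eq]; simp⟩
  | insert r T hrT ih =>
    intro L hL
    have hr := hL r (Finset.mem_insert_self _ _)
    obtain ⟨m, hm⟩ := ih (L ⊔ adjoin K {r})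
      fun x hx => le_sup_left (a := L) (hL x (Finset.mem_insert_of_mem hx))
    rw [sup_assoc, ← adjoin_union, Set.singleton_union, ← Finset.coe_insert] at hm
    by_cases hrL : r ∈ L
    · rw [sup_eq_left.2 (adjoin_simple_le_iff.2 hrL)] at hm
      exact ⟨m, hm⟩
    · rw [finrank_sup_adjoin_sqrt hr hrL] at hm
      exact ⟨m + 1, by rw [hm]; ring⟩

theorem finrank_sup_adjoin_sqrts [CharZero Ω] (T : Finset Ω) : ∀ (L : IntermediateField K Ω),
    (∀ r ∈ T, r ^ 2 ∈ L) → (∀ S ⊆ T, S.Nonempty → ∏ r ∈ S, r ∉ L) →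
    Module.finrank K ↥(L ⊔ adjoin K (T : Set Ω)) = 2 ^ T.card * Module.finrank K L := by
  classical
  induction T using Finset.induction_on with
  | empty => intro L _ _; rw [Finset.coe_empty, adjoin_empty, sup_bot_eq]; simp
  | insert r T hrT ih =>
    intro L hL hS
    have hr := hL r (Finset.mem_insert_self _ _)
    have hrL : r ∉ L := by
      simpa using hS {r} (by simp) (by simp)
    have hr0 : r ≠ 0 := by rintro rfl; exact hrL (zero_mem _)
    have h := ih (L ⊔ adjoin K {r})
      (fun x hx => le_sup_left (a := L) (hL x (Finset.mem_insert_of_mem hx))) ?_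
    · rw [sup_assoc, ← adjoin_union, Set.singleton_union, ← Finset.coe_insert,
        finrank_sup_adjoin_sqrt hr hrL] at h
      rw [h, Finset.card_insert_of_notMem hrT]; ring
    · intro S hST hSne hmem
      obtain ⟨u, hu, v, hv, huv⟩ := mem_sup_adjoin_sqrt hr hmem
      have hp2 : (∏ x ∈ S, x) ^ 2 ∈ L := by
        rw [← Finset.prod_pow]
        exact prod_mem fun x hx => hL x (Finset.mem_insert_of_mem (hST hx))
      by_cases huv0 : u * v = 0
      · rcases mul_eq_zero.1 huv0 with rfl | rfl
        · refine hS (insert r S) (Finset.insert_subset_insert _ hST) (by simp) ?_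
          rw [Finset.prod_insert (fun h => hrT (hST h)), huv]
          have : r * (0 + v * r) = v * r ^ 2 := by ring
          rw [this]
          exact mul_mem hv hr
        · refine hS S (hST.trans (Finset.subset_insert _ _)) hSne ?_
          rw [huv]; simpa using hu
      · apply hrL
        have : r = ((∏ x ∈ S, x) ^ 2 - u ^ 2 - v ^ 2 * r ^ 2) / (2 * (u * v)) := by
          rw [huv, eq_div_iff (mul_ne_zero two_ne_zero huv0)]; ring
        rw [this]
        exact div_mem (sub_mem (sub_mem hp2 (pow_mem hu 2)) (mul_mem (pow_mem hv 2) hr))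
          (mul_mem (ofNat_mem L 2) (mul_mem hu hv))

end QuadraticTower

open scoped Pointwise in
theorem isSquare_prod_roots_sub {K L : Type*} [Field K] [Field L] [DecidableEq L] [Algebra K L]
    [FiniteDimensional K L] [IsGalois K L] {m : ℕ} (hm : Module.finrank K L = 2 ^ m)
    {f : K[X]} (hf : Irreducible f) {c : K} (hc : f.eval c ≠ 0) {S : Finset L}
    (hS : S.Nonempty) (hSf : ∀ β ∈ S, aeval β f = 0)
    (hsq : IsSquare (∏ β ∈ S, (β - algebraMap K L c))) :
    IsSquare (∏ β ∈ (f.aroots L).toFinset, (β - algebraMap K L c)) := by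
  have hf0 := hf.ne_zero
  set R := (f.aroots L).toFinset with hR
  have hmemR : ∀ β, β ∈ R ↔ aeval β f = 0 := by
    intro β; rw [hR, Multiset.mem_toFinset, mem_aroots]; simp [hf0]
  have hne : ∀ β ∈ R, β - algebraMap K L c ≠ 0 := by
    intro β hβ h0
    rw [hmemR, sub_eq_zero.1 h0, aeval_algebraMap_apply] at hβ
    exact hc (by simpa [aeval_def] using hβ)
  let V : SubMulAction Gal(L/K) (Finset L) :=
    { carrier := {T | T ⊆ R ∧ IsSquare (∏ β ∈ T, (β - algebraMap K L c))}
      smul_mem' := by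
        rintro σ T ⟨hT, z, hz⟩
        refine ⟨?_, σ z, ?_⟩
        · intro x hx
          obtain ⟨y, hy, rfl⟩ := Finset.mem_smul_finset.1 hx
          have := (hmemR y).1 (hT hy)
          rw [hmemR, AlgEquiv.smul_def, ← AlgEquiv.coe_toAlgHom, aeval_algHom_apply, this, map_zero]
        · rw [← map_mul, ← hz, map_prod, Finset.smul_finset_def, Finset.prod_image]
          · refine Finset.prod_congr rfl fun x _ => ?_
            simp
          · intro x _ y _ h
            exact σ.injective h }
  have hVmem : ∀ T, T ∈ V ↔ T ⊆ R ∧ IsSquare (∏ β ∈ T, (β - algebraMap K L c)) := fun T => Iff.rfl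
  have : Finite V := Set.Finite.subset (Finset.finite_toSet R.powerset)
    (fun T hT => by simpa using hT.1)
  have hG : IsPGroup 2 Gal(L/K) := IsPGroup.of_card (n := m) (by
    rw [IsGalois.card_aut_eq_finrank, hm])
  have hmod := hG.card_modEq_card_fixedPoints V
  have hSV : S ∈ V := ⟨fun β hβ => (hmemR β).2 (hSf β hβ), hsq⟩
  have hclosed : ∀ T ∈ V, symmDiff T S ∈ V := by
    rintro T ⟨hT, hTs⟩
    refine ⟨fun x hx => ?_, ?_⟩
    · rcases Finset.mem_symmDiff.1 hx with h | h
      · exact hT h.1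
      · exact hSV.1 h.1
    · have e : (∏ β ∈ symmDiff T S, (β - algebraMap K L c)) *
          ((∏ β ∈ T ∩ S, (β - algebraMap K L c)) * ∏ β ∈ T ∩ S, (β - algebraMap K L c))
          = (∏ β ∈ T, (β - algebraMap K L c)) * ∏ β ∈ S, (β - algebraMap K L c) := by
        rw [← Finset.prod_union_inter (s₁ := T) (s₂ := S), ← Finset.prod_sdiff (s₁ := T ∩ S) (s₂ := T ∪ S),
          ← mul_assoc]
        · congr 3
          ext x; simp [Finset.mem_symmDiff]; tauto
        · exact Finset.inter_subset_union
      have hne' : (∏ β ∈ T ∩ S, (β - algebraMap K L c)) ≠ 0 :=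
        Finset.prod_ne_zero_iff.2 fun β hβ => hne β (hT (Finset.mem_inter.1 hβ).1)
      rw [← eq_div_iff (mul_ne_zero hne' hne')] at e
      rw [e]
      exact (hTs.mul hsq).div ⟨_, rfl⟩
  have heven : Even (Nat.card V) := by
    let : Fintype V := Fintype.ofFinite V
    rw [Nat.card_eq_fintype_card, ← ZMod.natCast_eq_zero_iff_even, ← Finset.card_univ]
    have := Finset.sum_involution (s := (Finset.univ : Finset V)) (f := fun _ => (1 : ZMod 2))
      (fun T _ => ⟨symmDiff T.1 S, hclosed _ T.2⟩) (fun _ _ => by decide)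
      (fun T _ _ h => hS.ne_empty (by simpa using congrArg Subtype.val h))
      (fun _ _ => Finset.mem_univ _) (fun T _ => Subtype.ext (by simp))
    simpa using this
  obtain ⟨T, hTfix, hT0⟩ : ∃ T : V, T ∈ MulAction.fixedPoints Gal(L/K) V ∧ T.1.Nonempty := by
    by_contra! hcon
    have h1 : Nat.card (MulAction.fixedPoints Gal(L/K) V) = 1 := by
      rw [Nat.card_eq_one_iff_unique]
      refine ⟨⟨fun a b => ?_⟩, ⟨⟨⟨∅, by simp [hVmem]⟩, fun σ => ?_⟩⟩⟩
      · apply Subtype.ext; apply Subtype.ext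
        rw [hcon _ a.2, hcon _ b.2]
      · apply Subtype.ext; exact Finset.smul_finset_empty σ
    rw [h1] at hmod
    rw [Nat.even_iff] at heven
    unfold Nat.ModEq at hmod
    omega
  have hTR : T.1 = R := by
    refine Finset.Subset.antisymm T.2.1 fun x hx => ?_
    obtain ⟨y, hy⟩ := hT0
    have h1 := (hmemR _).1 hx
    have h2 := (hmemR _).1 (T.2.1 hy)
    have : ∃ σ : Gal(L/K), σ y = x := by
      refine (Normal.minpoly_eq_iff_mem_orbit L).1 ?_
      rw [← minpoly.eq_of_irreducible hf h1, ← minpoly.eq_of_irreducible hf h2]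
    obtain ⟨σ, rfl⟩ := this
    have := congrArg Subtype.val (hTfix σ)
    rw [← this]
    exact Finset.smul_mem_smul_finset (a := σ) hy
  rw [← hTR]
  exact T.2.2

section Iterates

open IntermediateField

/-- The `n`-th iterate of a polynomial under composition. -/
noncomputable def iterComp {R : Type*} [CommRing R] (φ : R[X]) (n : ℕ) : R[X] :=
  (fun p => p.comp φ)^[n] X

section CommRing

variable {R : Type*} [CommRing R]

theorem iterComp_zero (φ : R[X]) : iterComp φ 0 = X := rfl

theorem iterComp_succ (φ : R[X]) (n : ℕ) : iterComp φ (n + 1) = (iterComp φ n).comp φ :=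
  Function.iterate_succ_apply' _ _ _

theorem eval_iterComp (φ : R[X]) (n : ℕ) (x : R) :
    (iterComp φ n).eval x = (fun a => φ.eval a)^[n] x := by
  induction n generalizing x with
  | zero => simp [iterComp_zero]
  | succ n ih => rw [iterComp_succ, eval_comp, ih, Function.iterate_succ_apply]

theorem map_iterComp {S : Type*} [CommRing S] (f : R →+* S) (φ : R[X]) (n : ℕ) :
    (iterComp φ n).map f = iterComp (φ.map f) n := by
  induction n with
  | zero => simp [iterComp_zero]
  | succ n ih => rw [iterComp_succ, map_comp, ih, iterComp_succ]

theorem natDegree_sq_add [Nontrivial R] (g c : R) : ((X - C g) ^ 2 + C c).natDegree = 2 := by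
  rw [natDegree_add_C, (monic_X_sub_C g).natDegree_pow, natDegree_X_sub_C]

theorem monic_sq_add (g c : R) : ((X - C g) ^ 2 + C c).Monic := by
  nontriviality R
  refine ((monic_X_sub_C g).pow 2).add_of_left ?_
  refine degree_C_le.trans_lt ?_
  rw [degree_eq_natDegree ((monic_X_sub_C g).pow 2).ne_zero,
    (monic_X_sub_C g).natDegree_pow, natDegree_X_sub_C]
  norm_num

theorem monic_iterComp [Nontrivial R] (g c : R) (n : ℕ) :
    (iterComp ((X - C g) ^ 2 + C c) n).Monic := by
  induction n with
  | zero => exact monic_X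
  | succ n ih =>
    rw [iterComp_succ]
    exact ih.comp (monic_sq_add g c) (by rw [natDegree_sq_add]; norm_num)

theorem natDegree_iterComp [IsDomain R] (g c : R) (n : ℕ) :
    (iterComp ((X - C g) ^ 2 + C c) n).natDegree = 2 ^ n := by
  induction n with
  | zero => simp [iterComp_zero]
  | succ n ih => rw [iterComp_succ, natDegree_comp, natDegree_sq_add, ih, pow_succ]

end CommRing

variable {K : Type*} (Ω : Type*) [Field K] [Field Ω] [Algebra K Ω]

/-- The field generated by the roots of the `n`-th iterate of `φ`. -/
abbrev iterField (φ : K[X]) (n : ℕ) : IntermediateField K Ω :=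
  adjoin K ((iterComp φ n).rootSet Ω)

theorem sq_mem_iterField {g c : K} {n : ℕ} {ρ : Ω → Ω}
    (hρ : ∀ β, ρ β ^ 2 = β - algebraMap K Ω c) {β : Ω}
    (hβ : β ∈ (iterComp ((X - C g) ^ 2 + C c) n).rootSet Ω) :
    ρ β ^ 2 ∈ iterField Ω ((X - C g) ^ 2 + C c) n := by
  rw [hρ]
  exact sub_mem (subset_adjoin K _ hβ) (IntermediateField.algebraMap_mem _ c)

variable [IsAlgClosed Ω]

theorem exists_iterField_succ (g c : K) (n : ℕ) : ∃ ρ : Ω → Ω,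
    (∀ β, ρ β ^ 2 = β - algebraMap K Ω c) ∧
    iterField Ω ((X - C g) ^ 2 + C c) (n + 1) = iterField Ω ((X - C g) ^ 2 + C c) n ⊔
      adjoin K (ρ '' (iterComp ((X - C g) ^ 2 + C c) n).rootSet Ω) := by
  choose ρ hρ using fun β : Ω => IsAlgClosed.exists_pow_nat_eq (β - algebraMap K Ω c) two_pos
  refine ⟨ρ, hρ, ?_⟩
  have hmem : ∀ n x, x ∈ (iterComp ((X - C g) ^ 2 + C c) n).rootSet Ω ↔
      aeval x (iterComp ((X - C g) ^ 2 + C c) n) = 0 := fun n x => by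
    rw [mem_rootSet]; simp [(monic_iterComp g c n).ne_zero]
  have hsucc : ∀ x, x ∈ (iterComp ((X - C g) ^ 2 + C c) (n + 1)).rootSet Ω ↔
      (x - algebraMap K Ω g) ^ 2 + algebraMap K Ω c ∈
        (iterComp ((X - C g) ^ 2 + C c) n).rootSet Ω := fun x => by
    rw [hmem, hmem, iterComp_succ, aeval_comp]; simp
  have hroot : ∀ β ∈ (iterComp ((X - C g) ^ 2 + C c) n).rootSet Ω,
      ρ β + algebraMap K Ω g ∈ (iterComp ((X - C g) ^ 2 + C c) (n + 1)).rootSet Ω := by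
    intro β hβ
    rw [hsucc]
    simpa [hρ] using hβ
  have hρmem : ∀ β ∈ (iterComp ((X - C g) ^ 2 + C c) n).rootSet Ω,
      ρ β ∈ iterField Ω ((X - C g) ^ 2 + C c) (n + 1) := fun β hβ => by
    simpa using sub_mem (subset_adjoin K _ (hroot β hβ))
      (IntermediateField.algebraMap_mem (iterField Ω ((X - C g) ^ 2 + C c) (n + 1)) g)
  apply le_antisymm
  · rw [adjoin_le_iff]
    intro x hx
    rw [hsucc] at hx
    set β := (x - algebraMap K Ω g) ^ 2 + algebraMap K Ω c with hβ
    have h1 : ρ β ∈ iterField Ω ((X - C g) ^ 2 + C c) n ⊔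
        adjoin K (ρ '' (iterComp ((X - C g) ^ 2 + C c) n).rootSet Ω) :=
      le_sup_right (a := iterField Ω ((X - C g) ^ 2 + C c) n)
        (subset_adjoin K _ (Set.mem_image_of_mem _ hx))
    have h2 : (x - algebraMap K Ω g) ^ 2 = ρ β ^ 2 := by rw [hρ, hβ]; ring
    rcases sq_eq_sq_iff_eq_or_eq_neg.1 h2 with h | h
    · rw [sub_eq_iff_eq_add] at h
      rw [h]
      exact add_mem h1 (IntermediateField.algebraMap_mem _ g)
    · rw [sub_eq_iff_eq_add] at h
      rw [h]
      exact add_mem (neg_mem h1) (IntermediateField.algebraMap_mem _ g)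
  · refine sup_le (adjoin_le_iff.2 fun β hβ => ?_) (adjoin_le_iff.2 ?_)
    · have : β = ρ β ^ 2 + algebraMap K Ω c := by rw [hρ]; ring
      rw [this]
      exact add_mem (pow_mem (hρmem β hβ) 2) (IntermediateField.algebraMap_mem _ c)
    · rintro _ ⟨β, hβ, rfl⟩
      exact hρmem β hβ

theorem exists_finrank_iterField (g c : K) (n : ℕ) :
    ∃ m, Module.finrank K (iterField Ω ((X - C g) ^ 2 + C c) n) = 2 ^ m := by
  classical
  induction n with
  | zero =>
    refine ⟨0, ?_⟩
    have : iterField Ω ((X - C g) ^ 2 + C c) 0 = ⊥ := by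
      rw [adjoin_eq_bot_iff, iterComp_zero]
      intro x hx
      rw [mem_rootSet, aeval_X] at hx
      rw [hx.2]
      exact zero_mem _
    rw [this, IntermediateField.finrank_bot, pow_zero]
  | succ n ih =>
    obtain ⟨m, hm⟩ := ih
    obtain ⟨ρ, hρ, h⟩ := exists_iterField_succ Ω g c n
    obtain ⟨m', hm'⟩ := exists_finrank_sup_adjoin_sqrts
      (((iterComp ((X - C g) ^ 2 + C c) n).rootSet Ω).toFinset.image ρ)
      (iterField Ω ((X - C g) ^ 2 + C c) n) (by
        intro r hr
        obtain ⟨β, hβ, rfl⟩ := Finset.mem_image.1 hr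
        exact sq_mem_iterField Ω hρ (Set.mem_toFinset.1 hβ))
    rw [Finset.coe_image, Set.coe_toFinset, ← h, hm, ← pow_add] at hm'
    exact ⟨_, hm'⟩

instance isSplittingField_iterField (φ : K[X]) (n : ℕ) :
    IsSplittingField K (iterField Ω φ n) (iterComp φ n) :=
  adjoin_rootSet_isSplittingField (IsAlgClosed.splits _)

theorem finrank_iterField_succ [CharZero K] {g c : K} {n : ℕ} (hn : 1 ≤ n)
    (hirr : Irreducible (iterComp ((X - C g) ^ 2 + C c) n))
    (hsq : ¬ IsSquare (algebraMap K (iterField Ω ((X - C g) ^ 2 + C c) n)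
      ((iterComp ((X - C g) ^ 2 + C c) n).eval c))) :
    Module.finrank K (iterField Ω ((X - C g) ^ 2 + C c) (n + 1)) =
      2 ^ 2 ^ n * Module.finrank K (iterField Ω ((X - C g) ^ 2 + C c) n) := by
  classical
  have : CharZero Ω := charZero_of_injective_algebraMap (algebraMap K Ω).injective
  obtain ⟨ρ, hρ, h⟩ := exists_iterField_succ Ω g c n
  obtain ⟨m, hm⟩ := exists_finrank_iterField Ω g c n
  set f := iterComp ((X - C g) ^ 2 + C c) n with hf
  set L := iterField Ω ((X - C g) ^ 2 + C c) n with hL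
  have : IsSplittingField K L f := isSplittingField_iterField Ω _ n
  have : FiniteDimensional K L := IsSplittingField.finiteDimensional L f
  have hsep : f.Separable := hirr.separable
  have : IsGalois K L := IsGalois.of_separable_splitting_field hsep
  have hmon : f.Monic := monic_iterComp g c n
  have hρinj : Function.Injective ρ := fun a b hab => by
    have := hρ a
    rw [hab, hρ b] at this
    exact (sub_left_inj.1 this).symm
  have hcard : ((f.rootSet Ω).toFinset.image ρ).card = 2 ^ n := by
    rw [Finset.card_image_of_injective _ hρinj, Set.toFinset_card,
      card_rootSet_eq_natDegree hsep (IsAlgClosed.splits _), natDegree_iterComp]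
  have hc0 : f.eval c ≠ 0 := fun h0 => hsq (by rw [h0, map_zero]; exact ⟨0, by simp⟩)
  have key := finrank_sup_adjoin_sqrts ((f.rootSet Ω).toFinset.image ρ) L (by
        intro r hr
        obtain ⟨β, hβ, rfl⟩ := Finset.mem_image.1 hr
        exact sq_mem_iterField Ω hρ (Set.mem_toFinset.1 hβ)) ?_
  · rw [hcard, Finset.coe_image, Set.coe_toFinset, ← h] at key
    exact key
  intro S hS hSne hSL
  apply hsq
  have hroots : ∀ β : L, β ∈ (f.aroots L).toFinset ↔ aeval β f = 0 := by
    intro β; rw [Multiset.mem_toFinset, mem_aroots]; simp [hmon.ne_zero]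
  have hlift : ∀ r ∈ S, ∃ β : L, aeval β f = 0 ∧ ρ β = r := by
    intro r hr
    obtain ⟨β, hβ, rfl⟩ := Finset.mem_image.1 (hS hr)
    rw [Set.mem_toFinset] at hβ
    refine ⟨⟨β, subset_adjoin K _ hβ⟩, ?_, rfl⟩
    apply (algebraMap L Ω).injective
    rw [← aeval_algebraMap_apply, map_zero]
    exact (mem_rootSet.1 hβ).2
  have hD := isSquare_prod_roots_sub (S := (f.aroots L).toFinset.filter fun β => ρ β ∈ S)
    hm hirr hc0 (by
      obtain ⟨r, hr⟩ := hSne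
      obtain ⟨β, hβ, hβr⟩ := hlift r hr
      exact ⟨β, Finset.mem_filter.2 ⟨(hroots β).2 hβ, hβr ▸ hr⟩⟩)
    (fun β hβ => (hroots β).1 (Finset.mem_filter.1 hβ).1) (by
      refine ⟨⟨_, hSL⟩, (algebraMap L Ω).injective ?_⟩
      rw [map_prod, map_mul]
      change _ = (∏ r ∈ S, r) * (∏ r ∈ S, r)
      rw [← Finset.prod_mul_distrib]
      refine Finset.prod_bij (fun β _ => ρ β) (fun β hβ => (Finset.mem_filter.1 hβ).2)
        (fun a _ b _ hab => Subtype.ext (hρinj hab)) (fun r hr => ?_) (fun β _ => ?_)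
      · obtain ⟨β, hβ, hβr⟩ := hlift r hr
        exact ⟨β, Finset.mem_filter.2 ⟨(hroots β).2 hβ, hβr ▸ hr⟩, hβr⟩
      · rw [← pow_two, hρ]; rfl)
  have hnodup : (f.aroots L).Nodup :=
    (nodup_aroots_iff_of_splits hmon.ne_zero (IsSplittingField.splits L f)).2 hsep
  convert hD using 1
  have hcard' : (f.aroots L).card = 2 ^ n := by
    rw [← (IsSplittingField.splits L f).natDegree_eq_card_roots, natDegree_map, natDegree_iterComp]
  rw [← eval_map_apply, (IsSplittingField.splits L f).eval_eq_prod_roots_of_monic (hmon.map _),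
    Finset.prod, Multiset.toFinset_val, hnodup.dedup]
  have hneg : (fun β : L => algebraMap K L c - β) = fun β => -1 * (β - algebraMap K L c) := by
    ext1 β; ring
  rw [hneg, Multiset.prod_map_mul, Multiset.map_const', Multiset.prod_replicate, hcard',
    (Nat.even_pow.2 ⟨even_two, by omega⟩ : Even (2 ^ n)).neg_one_pow, one_mul]

end Iterates

section LocalSplitting

open PowerSeries in
theorem PowerSeries.isSquare_of_constantCoeff_ne_zero {F : Type*} [Field F] [CharZero F]
    [IsAlgClosed F] {u : F⟦X⟧} (hu : constantCoeff u ≠ 0) : IsSquare u := by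
  obtain ⟨a, ha⟩ := IsAlgClosed.exists_pow_nat_eq (constantCoeff u) two_pos
  have ha0 : a ≠ 0 := by rintro rfl; apply hu; rw [← ha]; simp
  obtain ⟨v, hv, -⟩ := HenselianRing.is_henselian (I := Ideal.span {(X : F⟦X⟧)})
    (Polynomial.X ^ 2 - Polynomial.C u) (monic_X_pow_sub_C u two_ne_zero) (PowerSeries.C a)
    (by
      rw [Ideal.mem_span_singleton, PowerSeries.X_dvd_iff]
      simp [ha])
    (by
      refine IsUnit.map _ (PowerSeries.isUnit_iff_constantCoeff.2 ?_)
      simp [ha0])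
  refine ⟨v, ?_⟩
  have : v ^ 2 - u = 0 := by simpa [IsRoot] using hv
  rw [← pow_two, sub_eq_zero.1 this]

open PowerSeries in
theorem splits_iterComp_powerSeries {F : Type*} [Field F] [CharZero F] [IsAlgClosed F]
    (g c : F⟦X⟧) (n : ℕ)
    (h : ∀ j, 1 ≤ j → j ≤ n → constantCoeff
      ((iterComp ((Polynomial.X - Polynomial.C g) ^ 2 + Polynomial.C c) j).eval g) ≠ 0) :
    Splits (iterComp ((Polynomial.X - Polynomial.C g) ^ 2 + Polynomial.C c) n) := by
  induction n with
  | zero => exact Splits.X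
  | succ n ih =>
    have hs := ih fun j h1 h2 => h j h1 (by omega)
    have hn := h (n + 1) (by omega) le_rfl
    have hprod := hs.eq_prod_roots_of_monic (monic_iterComp g c n)
    set B := (iterComp ((Polynomial.X - Polynomial.C g) ^ 2 + Polynomial.C c) n).roots
    rw [iterComp_succ, hprod, multiset_prod_comp, Multiset.map_map] at hn ⊢
    rw [eval_multiset_prod, Multiset.map_map, map_multiset_prod, Multiset.map_map] at hn
    refine Splits.multisetProd fun p hp => ?_
    obtain ⟨β, hβ, rfl⟩ := Multiset.mem_map.1 hp
    have hβ0 : constantCoeff (β - c) ≠ 0 := by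
      intro h0
      apply hn
      refine Multiset.prod_eq_zero (Multiset.mem_map.2 ⟨β, hβ, ?_⟩)
      simp only [map_sub, sub_eq_zero] at h0
      simp [h0]
    obtain ⟨r, hr⟩ := PowerSeries.isSquare_of_constantCoeff_ne_zero hβ0
    have : ((fun p => p.comp ((Polynomial.X - Polynomial.C g) ^ 2 + Polynomial.C c)) ∘
        fun x => Polynomial.X - Polynomial.C x) β =
        (Polynomial.X - Polynomial.C (g + r)) * (Polynomial.X - Polynomial.C (g - r)) := by
      have h1 : Polynomial.C β = Polynomial.C c + Polynomial.C r * Polynomial.C r := by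
        rw [← Polynomial.C_mul, ← hr, ← Polynomial.C_add]; congr 1; ring
      simp [h1]; ring
    rw [this]
    exact (Splits.X_sub_C _).mul (Splits.X_sub_C _)

/-- Expansion of a polynomial as a power series around a point `α` of an extension field. -/
noncomputable def taylorSeries (k : Type*) {F : Type*} [Field k] [Field F] [Algebra k F] (α : F) :
    k[X] →+* PowerSeries F :=
  (Polynomial.coeToPowerSeries.ringHom.comp (taylorAlgHom α).toRingHom).comp
    (mapRingHom (algebraMap k F))

theorem taylorSeries_apply {k F : Type*} [Field k] [Field F] [Algebra k F] (α : F) (p : k[X]) :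
    taylorSeries k α p = (taylor α (p.map (algebraMap k F)) : F[X]) := rfl

theorem taylorSeries_injective {k F : Type*} [Field k] [Field F] [Algebra k F] (α : F) :
    Function.Injective (taylorSeries k α) := fun p q h => by
  rw [taylorSeries_apply, taylorSeries_apply, Polynomial.coe_inj] at h
  exact map_injective _ (algebraMap k F).injective (taylor_injective α h)

theorem constantCoeff_taylorSeries {k F : Type*} [Field k] [Field F] [Algebra k F] (α : F)
    (p : k[X]) : PowerSeries.constantCoeff (taylorSeries k α p)
      = (p.map (algebraMap k F)).eval α := by
  rw [taylorSeries_apply, ← PowerSeries.coeff_zero_eq_constantCoeff_apply, Polynomial.coeff_coe,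
    taylor_coeff_zero]

theorem order_taylorSeries {k F : Type*} [Field k] [Field F] [Algebra k F] (α : F)
    {p : k[X]} (hp : p ≠ 0) :
    (taylorSeries k α p).order = rootMultiplicity α (p.map (algebraMap k F)) := by
  have hp' : p.map (algebraMap k F) ≠ 0 := Polynomial.map_ne_zero hp
  obtain ⟨q, hq, hdvd⟩ := exists_eq_pow_rootMultiplicity_mul_and_not_dvd _ hp' α
  set m := rootMultiplicity α (p.map (algebraMap k F))
  rw [taylorSeries_apply, hq, taylor_mul, taylor_pow]
  simp only [map_sub, taylor_X, taylor_C, add_sub_cancel_right, Polynomial.coe_mul,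
    Polynomial.coe_pow, Polynomial.coe_X]
  rw [PowerSeries.order_mul, PowerSeries.order_X_pow]
  have : (taylor α q : PowerSeries F).order = 0 := by
    by_contra h0
    rw [← ne_eq, PowerSeries.order_ne_zero_iff_constCoeff_eq_zero,
      ← PowerSeries.coeff_zero_eq_constantCoeff_apply, Polynomial.coeff_coe,
      taylor_coeff_zero] at h0
    exact hdvd (dvd_iff_isRoot.2 h0)
  rw [this, add_zero]

theorem even_rootMultiplicity_of_isSquare {k F : Type*} [Field k] [Field F] [CharZero F]
    [IsAlgClosed F] [Algebra k F] {Ω : Type*} [Field Ω] [Algebra (RatFunc k) Ω] [IsAlgClosed Ω]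
    {g c b : k[X]} {n : ℕ} {α : F} (hb : b ≠ 0)
    (hα : ∀ j, 1 ≤ j → j ≤ n → (((iterComp ((X - C g) ^ 2 + C c) j).eval g).map
      (algebraMap k F)).eval α ≠ 0)
    (hsq : IsSquare (algebraMap (RatFunc k) (iterField Ω ((X - C (algebraMap k[X] (RatFunc k) g)) ^ 2
        + C (algebraMap k[X] (RatFunc k) c)) n) (algebraMap k[X] (RatFunc k) b))) :
    Even (rootMultiplicity α (b.map (algebraMap k F))) := by
  let ι := taylorSeries k α
  let M := FractionRing (PowerSeries F)
  have hinj : Function.Injective ((algebraMap (PowerSeries F) M).comp ι) :=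
    (IsFractionRing.injective (PowerSeries F) M).comp (taylorSeries_injective α)
  let τ : RatFunc k →+* M := IsFractionRing.lift hinj
  have hτ : ∀ p, τ (algebraMap k[X] (RatFunc k) p) = algebraMap (PowerSeries F) M (ι p) :=
    fun p => IsFractionRing.lift_algebraMap hinj p
  let : Algebra (RatFunc k) M := τ.toAlgebra
  have hsplit := splits_iterComp_powerSeries (ι g) (ι c) n (by
    intro j h1 h2
    have := hα j h1 h2
    rw [← constantCoeff_taylorSeries] at this
    convert this using 2
    rw [← eval_map_apply, map_iterComp]
    simp [ι])
  have hsplitM := hsplit.map (algebraMap (PowerSeries F) M)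
  set Φ := (X - C (algebraMap k[X] (RatFunc k) g)) ^ 2
    + C (algebraMap k[X] (RatFunc k) c) with hΦ
  obtain ⟨z, hz⟩ := hsq
  have hmap : (iterComp Φ n).map (algebraMap (RatFunc k) M) =
      (iterComp ((X - C (ι g)) ^ 2 + C (ι c)) n).map (algebraMap (PowerSeries F) M) := by
    rw [map_iterComp, map_iterComp]
    simp [hΦ, RingHom.algebraMap_toAlgebra, hτ]
  let θ : iterField Ω Φ n →ₐ[RatFunc k] M := IsSplittingField.lift _ (iterComp Φ n) (by
    rw [hmap]; exact hsplitM)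
  have h1 := congrArg θ hz
  rw [θ.commutes, map_mul, RingHom.algebraMap_toAlgebra, hτ] at h1
  obtain ⟨y, hy⟩ : ∃ y : PowerSeries F, algebraMap _ M y = θ z :=
    IsIntegrallyClosed.exists_algebraMap_eq_of_isIntegral_pow two_pos (by
      rw [pow_two, ← h1]; exact isIntegral_algebraMap)
  rw [← hy, ← map_mul] at h1
  have h2 := IsFractionRing.injective (PowerSeries F) M h1
  have h3 := congrArg PowerSeries.order h2
  rw [order_taylorSeries α hb, PowerSeries.order_mul] at h3
  have hfin : y.order ≠ ⊤ := fun h => by simp [h] at h3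
  lift y.order to ℕ using hfin with o
  exact ⟨o, by exact_mod_cast h3⟩

end LocalSplitting

section CriticalOrbit

theorem exists_eq_mul_sq {F : Type*} [Field F] [IsAlgClosed F] {b P : F[X]} (hP : P ≠ 0)
    (h : ∀ α, Odd (rootMultiplicity α b) → P.eval α = 0) :
    ∃ d y : F[X], b = d * y ^ 2 ∧ d.natDegree ≤ P.natDegree := by
  classical
  refine ⟨C b.leadingCoeff * ∏ α ∈ b.roots.toFinset, (X - C α) ^ (rootMultiplicity α b % 2),
    ∏ α ∈ b.roots.toFinset, (X - C α) ^ (rootMultiplicity α b / 2), ?_, ?_⟩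
  · conv_lhs => rw [(IsAlgClosed.splits b).eq_prod_roots, Finset.prod_multiset_map_count]
    rw [mul_assoc, ← Finset.prod_pow, ← Finset.prod_mul_distrib]
    congr 1
    refine Finset.prod_congr rfl fun α _ => ?_
    rw [← pow_mul, ← pow_add, count_roots]
    congr 1
    omega
  · refine (natDegree_C_mul_le _ _).trans ?_
    rw [natDegree_prod_of_monic _ _ fun α _ => (monic_X_sub_C α).pow _]
    simp only [natDegree_pow, natDegree_X_sub_C, mul_one]
    calc ∑ α ∈ b.roots.toFinset, rootMultiplicity α b % 2
        = ∑ α ∈ b.roots.toFinset with Odd (rootMultiplicity α b), 1 := by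
          rw [Finset.sum_filter]
          refine Finset.sum_congr rfl fun α _ => ?_
          split_ifs with ho
          · exact Nat.odd_iff.1 ho
          · exact Nat.even_iff.1 (Nat.not_odd_iff_even.1 ho)
      _ = (b.roots.toFinset.filter fun α => Odd (rootMultiplicity α b)).card := by simp
      _ ≤ P.roots.toFinset.card := by
          refine Finset.card_le_card fun α hα => ?_
          rw [Multiset.mem_toFinset, mem_roots hP]
          exact h α (Finset.mem_filter.1 hα).2
      _ ≤ P.natDegree := (Multiset.toFinset_card_le _).trans (card_roots' P)

/-- The `n`-th iterate of `x` under the quadratic map `a ↦ (a - γ)² + c`. -/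
def quadOrbit {A : Type*} [CommRing A] (γ c x : A) (n : ℕ) : A :=
  (fun a => (a - γ) ^ 2 + c)^[n] x

section CommRing

variable {A : Type*} [CommRing A]

theorem quadOrbit_zero (γ c x : A) : quadOrbit γ c x 0 = x := rfl

theorem quadOrbit_succ (γ c x : A) (n : ℕ) :
    quadOrbit γ c x (n + 1) = (quadOrbit γ c x n - γ) ^ 2 + c :=
  Function.iterate_succ_apply' _ _ _

theorem quadOrbit_add (γ c x : A) (m n : ℕ) :
    quadOrbit γ c x (m + n) = quadOrbit γ c (quadOrbit γ c x n) m :=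
  Function.iterate_add_apply _ _ _ _

theorem map_quadOrbit {B : Type*} [CommRing B] (f : A →+* B) (γ c x : A) (n : ℕ) :
    f (quadOrbit γ c x n) = quadOrbit (f γ) (f c) (f x) n := by
  induction n with
  | zero => rfl
  | succ n ih => rw [quadOrbit_succ, quadOrbit_succ, ← ih]; simp

theorem eval_iterComp_eq_quadOrbit (γ c x : A) (n : ℕ) :
    (iterComp ((X - C γ) ^ 2 + C c) n).eval x = quadOrbit γ c x n := by
  rw [eval_iterComp]; simp [quadOrbit]

theorem quadOrbit_injective_of_infinite {γ c x : A}
    (h : {y | ∃ n : ℕ, 1 ≤ n ∧ quadOrbit γ c x n = y}.Infinite) :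
    Function.Injective (quadOrbit γ c x) := by
  have key : ∀ i p, quadOrbit γ c x i ≠ quadOrbit γ c x (i + p + 1) := by
    intro i p heq
    refine h (((Set.finite_lt_nat (i + p + 1)).image (quadOrbit γ c x)).subset ?_)
    rintro _ ⟨n, -, rfl⟩
    induction n using Nat.strong_induction_on with
    | _ n ih =>
      by_cases hn : n < i + p + 1
      · exact ⟨n, hn, rfl⟩
      · obtain ⟨m, rfl⟩ := Nat.exists_eq_add_of_le (not_lt.1 hn)
        rw [add_comm (i + p + 1), quadOrbit_add, ← heq, ← quadOrbit_add]
        exact ih _ (by omega)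
  intro i j hij
  rcases lt_trichotomy i j with hlt | heq | hlt
  · obtain ⟨p, rfl⟩ := Nat.exists_eq_add_of_lt hlt
    exact (key i p hij).elim
  · exact heq
  · obtain ⟨p, rfl⟩ := Nat.exists_eq_add_of_lt hlt
    exact (key j p hij.symm).elim

end CommRing

variable {F : Type*} [Field F]

theorem natDegree_quadOrbit_le {γ c x : F[X]} {H : ℕ} (hγ : γ.natDegree ≤ H)
    (hc : c.natDegree ≤ H) (hx : x.natDegree ≤ H) (n : ℕ) :
    (quadOrbit γ c x n).natDegree ≤ 2 ^ n * H := by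
  induction n with
  | zero => simpa [quadOrbit_zero] using hx
  | succ n ih =>
    have h1 : H ≤ 2 ^ n * H := Nat.le_mul_of_pos_left _ (by positivity)
    have h2 : (quadOrbit γ c x n - γ).natDegree ≤ 2 ^ n * H :=
      (natDegree_sub_le _ _).trans (max_le ih (hγ.trans h1))
    have h3 : 2 ^ (n + 1) * H = 2 * (2 ^ n * H) := by ring
    rw [quadOrbit_succ, h3]
    refine (natDegree_add_le _ _).trans (max_le ?_ (by omega))
    rw [natDegree_pow]
    omega

theorem quadOrbit_sub_succ (γ c : F[X]) (n : ℕ) :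
    quadOrbit γ c γ (n + 1) - γ = (quadOrbit γ c γ n - γ) ^ 2 + (c - γ) := by
  rw [quadOrbit_succ]; ring

theorem natDegree_quadOrbit_sub {γ c : F[X]} (h : 0 < (c - γ).natDegree) (n : ℕ) :
    (quadOrbit γ c γ (n + 1) - γ).natDegree = 2 ^ n * (c - γ).natDegree := by
  induction n with
  | zero => simp [quadOrbit_sub_succ, quadOrbit_zero]
  | succ n ih =>
    have : (c - γ).natDegree < ((quadOrbit γ c γ (n + 1) - γ) ^ 2).natDegree := by
      rw [natDegree_pow, ih]
      have : 0 < 2 ^ n := by positivity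
      nlinarith
    rw [quadOrbit_sub_succ, natDegree_add_eq_left_of_natDegree_lt this, natDegree_pow, ih, pow_succ]
    ring

theorem exists_eval_quadOrbit_eq_zero {γ c : F[X]} {α : F} {n j : ℕ} (hj : 1 ≤ j) (hjn : j ≤ n)
    (h1 : (quadOrbit γ c γ (n + 1)).eval α = 0) (h2 : (quadOrbit γ c γ j).eval α = 0) :
    ∃ i ∈ Finset.Icc 1 ((n + 1) / 2),
      (quadOrbit γ c γ i * quadOrbit γ c 0 i).eval α = 0 := by
  by_cases hj2 : j ≤ (n + 1) / 2
  · exact ⟨j, Finset.mem_Icc.2 ⟨hj, hj2⟩, by rw [eval_mul, h2, zero_mul]⟩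
  · obtain ⟨m, hm⟩ : ∃ m, n + 1 = m + j := ⟨n + 1 - j, by omega⟩
    refine ⟨m, Finset.mem_Icc.2 ⟨by omega, by omega⟩, ?_⟩
    rw [hm, quadOrbit_add] at h1
    rw [eval_mul]
    have h3 := map_quadOrbit (evalRingHom α) γ c (quadOrbit γ c γ j) m
    have h4 := map_quadOrbit (evalRingHom α) γ c 0 m
    simp only [coe_evalRingHom, eval_zero] at h3 h4
    rw [h2, h1] at h3
    rw [h4, ← h3, mul_zero]

variable [CharZero F] [IsAlgClosed F]

/-- In the non-isotrivial case, every late term of the critical orbit has a zero of odd order which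
is not a zero of an earlier term. -/
theorem exists_new_odd_root_of_natDegree_pos {γ c : F[X]}
    (hne : ∀ n, 1 ≤ n → quadOrbit γ c γ n ≠ 0) (hne0 : ∀ n, 1 ≤ n → quadOrbit γ c 0 n ≠ 0)
    (hs : 0 < (c - γ).natDegree) : ∃ N, ∀ n, N ≤ n →
      ∃ α, Odd (rootMultiplicity α (quadOrbit γ c γ (n + 1))) ∧
        ∀ j, 1 ≤ j → j ≤ n → (quadOrbit γ c γ j).eval α ≠ 0 := by
  set H := max γ.natDegree c.natDegree with hH
  refine ⟨84 * H + 10, fun n hn => ?_⟩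
  by_contra! hcon
  obtain ⟨m, rfl⟩ : ∃ m, n = m + 3 := ⟨n - 3, by omega⟩
  set P := ∏ i ∈ Finset.Icc 1 ((m + 3 + 1) / 2), (quadOrbit γ c γ i * quadOrbit γ c 0 i) with hPdef
  have hP : P ≠ 0 := Finset.prod_ne_zero_iff.2 fun i hi =>
    mul_ne_zero (hne i (Finset.mem_Icc.1 hi).1) (hne0 i (Finset.mem_Icc.1 hi).1)
  obtain ⟨d, y, hdy, hd⟩ := exists_eq_mul_sq (b := quadOrbit γ c γ (m + 3 + 1)) hP (by
    intro α hα
    obtain ⟨j, hj, hjn, h0⟩ := hcon α hα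
    have h1 : (quadOrbit γ c γ (m + 3 + 1)).eval α = 0 := by
      have : 0 < rootMultiplicity α (quadOrbit γ c γ (m + 3 + 1)) := hα.pos
      exact ((rootMultiplicity_pos (hne _ (by omega))).1 this)
    obtain ⟨i, hi, h2⟩ := exists_eval_quadOrbit_eq_zero hj hjn h1 h0
    rw [hPdef, eval_prod]
    exact Finset.prod_eq_zero hi h2)
  have hγH : γ.natDegree ≤ H := le_max_left _ _
  have hcH : c.natDegree ≤ H := le_max_right _ _
  have hPdeg : ∀ M, (∏ i ∈ Finset.Icc 1 M, (quadOrbit γ c γ i * quadOrbit γ c 0 i)).natDegree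
      ≤ 2 ^ (M + 2) * H := by
    intro M
    induction M with
    | zero => simp
    | succ M ih =>
      rw [Finset.prod_Icc_succ_top (by omega)]
      refine natDegree_mul_le.trans ?_
      have h1 := natDegree_mul_le (p := quadOrbit γ c γ (M + 1)) (q := quadOrbit γ c 0 (M + 1))
      have h2 := natDegree_quadOrbit_le hγH hcH hγH (M + 1)
      have h3 := natDegree_quadOrbit_le (x := 0) hγH hcH (by simp) (M + 1)
      calc _ ≤ 2 ^ (M + 2) * H + (2 ^ (M + 1) * H + 2 ^ (M + 1) * H) := by omega
        _ = 2 ^ (M + 1 + 2) * H := by ring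
  rw [quadOrbit_succ, quadOrbit_sub_succ, quadOrbit_sub_succ] at hdy
  refine sq_add_ne_mul_sq (H := H) (D := P.natDegree) ?_ ?_ ?_ ?_ hcH hd ?_ hdy
  · rintro h0; rw [h0] at hs; simp at hs
  · simpa [quadOrbit_succ, quadOrbit_zero] using hne 1 le_rfl
  · simpa [quadOrbit_succ, quadOrbit_zero] using hne 2 (by norm_num)
  · exact (natDegree_sub_le _ _).trans (max_le hcH hγH)
  · rw [natDegree_quadOrbit_sub hs]
    have h1 := hPdeg ((m + 3 + 1) / 2)
    rw [← hPdef] at h1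
    set q := m / 2 with hq
    have h2 : (m + 3 + 1) / 2 + 2 = q + 4 := by omega
    rw [h2, pow_add] at h1
    have hQ : 42 * H + 1 < 2 ^ q := lt_of_le_of_lt (by omega) (Nat.lt_two_pow_self)
    have h3 : 2 ^ q * 2 ^ q ≤ 2 ^ m := by
      rw [← pow_add]; exact Nat.pow_le_pow_right two_pos (by omega)
    have h4 : 2 ^ m ≤ 2 ^ m * (c - γ).natDegree := Nat.le_mul_of_pos_right _ hs
    nlinarith

/-- In the isotrivial case, at most one term of the critical orbit fails to have a zero of odd order
which is not a zero of an earlier term. -/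
theorem exists_new_odd_root_of_natDegree_eq_zero {γ c : F[X]}
    (hne : ∀ n, 1 ≤ n → quadOrbit γ c γ n ≠ 0)
    (hinj : Function.Injective (quadOrbit γ c γ))
    (hγ : 0 < γ.natDegree) (hs : (c - γ).natDegree = 0) : ∃ N, ∀ n, N ≤ n →
      ∃ α, Odd (rootMultiplicity α (quadOrbit γ c γ (n + 1))) ∧
        ∀ j, 1 ≤ j → j ≤ n → (quadOrbit γ c γ j).eval α ≠ 0 := by
  obtain ⟨σ, hσ⟩ := natDegree_eq_zero.1 hs
  have hτ : ∀ n, ∃ τ, quadOrbit γ c γ n = γ + C τ := by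
    intro n
    induction n with
    | zero => exact ⟨0, by simp [quadOrbit_zero]⟩
    | succ n ih =>
      obtain ⟨τ, h⟩ := ih
      refine ⟨τ ^ 2 + σ, ?_⟩
      rw [← sub_eq_iff_eq_add', quadOrbit_sub_succ, h, ← hσ]; simp
  choose τ hτ using hτ
  have hτinj : Function.Injective τ := fun i j hij => hinj (by rw [hτ, hτ, hij])
  have hbad : ∀ n, (∀ α, Odd (rootMultiplicity α (quadOrbit γ c γ (n + 1))) →
      ∃ j, 1 ≤ j ∧ j ≤ n ∧ (quadOrbit γ c γ j).eval α = 0) →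
      ∃ d y : F[X], γ + C (τ (n + 1)) = d * y ^ 2 ∧ d.natDegree = 0 := by
    intro n hn
    obtain ⟨d, y, hdy, hd⟩ := exists_eq_mul_sq (b := quadOrbit γ c γ (n + 1)) one_ne_zero (by
      intro α hα
      obtain ⟨j, hj, hjn, h0⟩ := hn α hα
      have h1 : (quadOrbit γ c γ (n + 1)).eval α = 0 :=
        (rootMultiplicity_pos (hne _ (by omega))).1 hα.pos
      rw [hτ] at h0 h1
      simp only [eval_add, eval_C] at h0 h1
      have := hτinj (add_left_cancel (h0.trans h1.symm))
      omega)
    rw [natDegree_one] at hd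
    exact ⟨d, y, by rw [← hτ, hdy], by omega⟩
  have hγ' : derivative γ ≠ 0 := fun h0 => hγ.ne' (derivative_eq_zero.1 h0)
  have hunique : ∀ i j, i ≠ j → ∀ d y d' y' : F[X], γ + C (τ i) = d * y ^ 2 → d.natDegree = 0 →
      γ + C (τ j) = d' * y' ^ 2 → d'.natDegree = 0 → False := by
    intro i j hij d y d' y' h hd h' hd'
    have hdvd : ∀ (t : F) (d y : F[X]), γ + C t = d * y ^ 2 → d.natDegree = 0 →
        y ∣ derivative γ ∧ γ.natDegree = 2 * y.natDegree := by
      intro t d y h hd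
      have h0 : (γ + C t).natDegree = γ.natDegree := natDegree_add_C
      have hne : d * y ^ 2 ≠ 0 := by
        rw [← h]; intro h1; rw [h1] at h0; simp at h0; omega
      refine ⟨⟨derivative d * y + 2 * d * derivative y, ?_⟩, ?_⟩
      · have := congrArg derivative h
        rw [derivative_add, derivative_C, add_zero, derivative_mul, derivative_sq, map_ofNat] at this
        rw [this]; ring
      · rw [← h0, h, natDegree_mul (left_ne_zero_of_mul hne) (right_ne_zero_of_mul hne), hd,
          natDegree_pow, zero_add]
    obtain ⟨h1, h2⟩ := hdvd _ _ _ h hd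
    obtain ⟨h1', h2'⟩ := hdvd _ _ _ h' hd'
    have hcop : IsCoprime y y' := by
      have hne : τ i - τ j ≠ 0 := sub_ne_zero.2 fun h => hij (hτinj h)
      refine ⟨C (τ i - τ j)⁻¹ * (d * y), - C (τ i - τ j)⁻¹ * (d' * y'), ?_⟩
      have h3 : (C (τ i - τ j)⁻¹ : F[X]) * (C (τ i) - C (τ j)) = 1 := by
        rw [← C_sub, ← C_mul, inv_mul_cancel₀ hne, C_1]
      linear_combination h3 - C (τ i - τ j)⁻¹ * h + C (τ i - τ j)⁻¹ * h'
    have h4 := natDegree_le_of_dvd (hcop.mul_dvd h1 h1') hγ'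
    have hy0 : y ≠ 0 := by rintro rfl; simp at h2; omega
    have hy0' : y' ≠ 0 := by rintro rfl; simp at h2'; omega
    rw [natDegree_mul hy0 hy0'] at h4
    have := natDegree_derivative_lt hγ.ne'
    omega
  by_contra! hcon
  obtain ⟨n, -, hn⟩ := hcon 0
  obtain ⟨n', hnn', hn'⟩ := hcon (n + 1)
  obtain ⟨d, y, h, hd⟩ := hbad n hn
  obtain ⟨d', y', h', hd'⟩ := hbad n' hn'
  exact hunique (n + 1) (n' + 1) (by omega) d y d' y' h hd h' hd'

theorem exists_new_odd_root {γ c : F[X]}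
    (hne : ∀ n, 1 ≤ n → quadOrbit γ c γ n ≠ 0) (hne0 : ∀ n, 1 ≤ n → quadOrbit γ c 0 n ≠ 0)
    (hinj : Function.Injective (quadOrbit γ c γ))
    (hht : 0 < max γ.natDegree c.natDegree) : ∃ N, ∀ n, N ≤ n →
      ∃ α, Odd (rootMultiplicity α (quadOrbit γ c γ (n + 1))) ∧
        ∀ j, 1 ≤ j → j ≤ n → (quadOrbit γ c γ j).eval α ≠ 0 := by
  rcases Nat.eq_zero_or_pos (c - γ).natDegree with hs | hs
  · refine exists_new_odd_root_of_natDegree_eq_zero hne hinj ?_ hs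
    by_contra h0
    have h1 : (c - γ + γ).natDegree ≤ _ := natDegree_add_le _ _
    rw [sub_add_cancel] at h1
    rw [lt_max_iff] at hht
    have := h1.trans (max_le hs.le (by omega : γ.natDegree ≤ 0))
    omega
  · exact exists_new_odd_root_of_natDegree_pos hne hne0 hs

end CriticalOrbit

section Main

variable {k : Type*} [Field k]

theorem quadOrbit_ne_zero_of_irreducible {γ c : k[X]} {n : ℕ} (hn : 1 ≤ n)
    (hirr : Irreducible (iterComp ((X - C (algebraMap k[X] (RatFunc k) γ)) ^ 2
      + C (algebraMap k[X] (RatFunc k) c)) n)) (x : k[X]) : quadOrbit γ c x n ≠ 0 := by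
  intro h0
  have hroot : IsRoot (iterComp ((X - C (algebraMap k[X] (RatFunc k) γ)) ^ 2
      + C (algebraMap k[X] (RatFunc k) c)) n) (algebraMap k[X] (RatFunc k) x) := by
    rw [IsRoot, eval_iterComp_eq_quadOrbit, ← map_quadOrbit, h0, map_zero]
  have h1 : _ = 1 := natDegree_eq_of_degree_eq_some (degree_eq_one_of_irreducible_of_root hirr hroot)
  rw [natDegree_iterComp] at h1
  have : 2 ^ 1 ≤ 2 ^ n := Nat.pow_le_pow_right two_pos hn
  omega

theorem exists_finrank_iterField_succ_eq [CharZero k] {γ c : k[X]}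
    (hirr : ∀ n, 1 ≤ n → Irreducible (iterComp ((X - C (algebraMap k[X] (RatFunc k) γ)) ^ 2
      + C (algebraMap k[X] (RatFunc k) c)) n))
    (hpci : {x | ∃ n : ℕ, 1 ≤ n ∧ quadOrbit γ c γ n = x}.Infinite)
    (hht : 0 < max γ.natDegree c.natDegree)
    (Ω : Type*) [Field Ω] [Algebra (RatFunc k) Ω] [IsAlgClosed Ω] :
    ∃ N, ∀ n, N ≤ n → Module.finrank (RatFunc k)
        (iterField Ω ((X - C (algebraMap k[X] (RatFunc k) γ)) ^ 2
          + C (algebraMap k[X] (RatFunc k) c)) (n + 1)) =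
      2 ^ 2 ^ n * Module.finrank (RatFunc k)
        (iterField Ω ((X - C (algebraMap k[X] (RatFunc k) γ)) ^ 2
          + C (algebraMap k[X] (RatFunc k) c)) n) := by
  let F := AlgebraicClosure k
  have hinjF : Function.Injective (mapRingHom (algebraMap k F)) :=
    map_injective _ (algebraMap k F).injective
  have hmap : ∀ (x : k[X]) (n : ℕ), quadOrbit (γ.map (algebraMap k F)) (c.map (algebraMap k F))
      (x.map (algebraMap k F)) n = (quadOrbit γ c x n).map (algebraMap k F) :=
    fun x n => (map_quadOrbit (mapRingHom (algebraMap k F)) γ c x n).symm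
  have hne : ∀ (x : k[X]) (n : ℕ), 1 ≤ n → quadOrbit (γ.map (algebraMap k F)) (c.map (algebraMap k F))
      (x.map (algebraMap k F)) n ≠ 0 := fun x n hn => by
    rw [hmap]
    exact Polynomial.map_ne_zero (quadOrbit_ne_zero_of_irreducible hn (hirr n hn) x)
  obtain ⟨N, hN⟩ := exists_new_odd_root (hne γ) (by simpa using hne 0)
    (fun i j hij => quadOrbit_injective_of_infinite hpci (hinjF (by simpa [hmap] using hij)))
    (by simpa using hht)
  refine ⟨max N 1, fun n hn => ?_⟩
  have hn1 : 1 ≤ n := le_of_max_le_right hn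
  refine finrank_iterField_succ Ω hn1 (hirr n hn1) fun hsq => ?_
  obtain ⟨α, hodd, hα⟩ := hN n (le_of_max_le_left hn)
  rw [hmap] at hodd
  refine Nat.not_even_iff_odd.2 hodd (even_rootMultiplicity_of_isSquare (Ω := Ω) (n := n)
    (quadOrbit_ne_zero_of_irreducible (by omega) (hirr (n + 1) (by omega)) γ) ?_ ?_ (g := γ)
    (c := c))
  · intro j h1 h2
    rw [eval_iterComp_eq_quadOrbit, ← hmap]
    exact hα j h1 h2
  · rw [eval_iterComp_eq_quadOrbit, ← map_quadOrbit] at hsq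
    have : quadOrbit γ c γ (n + 1) = quadOrbit γ c c n := by
      rw [quadOrbit_add]; simp [quadOrbit_succ, quadOrbit_zero]
    rwa [this]

end Main

/-- Finite Index Theorem (Theorem 1, qualitative form): if `φ = (x-γ)²+c` over `K = k(t)`
is stable, post-critically infinite, and `h(φ) > 0`, then the arboreal representation has
finite index: there is `C ≥ 1` with `2^(2^n - 1) ≤ C · [K_n : K]` for all `n ≥ 1`. -/
theorem finite_index_theorem (k : Type*) [Field k] [CharZero k] (γ c : Polynomial k)
    (φ : Polynomial (RatFunc k))
    (hφ : φ = (X - C (algebraMap (Polynomial k) (RatFunc k) γ)) ^ 2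
            + C (algebraMap (Polynomial k) (RatFunc k) c))
    (hstable : ∀ n : ℕ, 1 ≤ n →
      Irreducible ((fun p => p.comp φ)^[n] (X : Polynomial (RatFunc k))))
    (hpci : Set.Infinite
      {x : Polynomial k | ∃ n : ℕ, 1 ≤ n ∧ (fun a => (a - γ) ^ 2 + c)^[n] γ = x})
    (hht : 0 < max γ.natDegree c.natDegree) :
    ∃ N : ℕ, 1 ≤ N ∧ ∀ n : ℕ, 1 ≤ n →
      2 ^ (2 ^ n - 1) ≤ N * Module.finrank (RatFunc k)
        (Polynomial.SplittingField ((fun p => p.comp φ)^[n] (X : Polynomial (RatFunc k)))) := by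
  subst hφ
  obtain ⟨N, hN⟩ := exists_finrank_iterField_succ_eq hstable hpci hht
    (AlgebraicClosure (RatFunc k))
  set Φ := (X - C (algebraMap k[X] (RatFunc k) γ)) ^ 2 + C (algebraMap k[X] (RatFunc k) c)
  have hpos : ∀ n, 1 ≤ Module.finrank (RatFunc k)
      (iterField (AlgebraicClosure (RatFunc k)) Φ n) := fun n => by
    have := IsSplittingField.finiteDimensional
      (iterField (AlgebraicClosure (RatFunc k)) Φ n) (iterComp Φ n)
    exact Module.finrank_pos
  have hbound : ∀ n, 2 ^ (2 ^ n - 1) ≤ 2 ^ (2 ^ N - 1) * Module.finrank (RatFunc k)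
      (iterField (AlgebraicClosure (RatFunc k)) Φ n) := by
    intro n
    induction n with
    | zero => simpa using Nat.mul_le_mul Nat.one_le_two_pow (hpos 0)
    | succ n ih =>
      by_cases hn : N ≤ n
      · have hexp : 2 ^ (n + 1) - 1 = 2 ^ n + (2 ^ n - 1) := by
          have := Nat.one_le_two_pow (n := n)
          rw [pow_succ]; omega
        rw [hN n hn, hexp, pow_add, mul_left_comm]
        exact Nat.mul_le_mul_left _ ih
      · refine le_trans ?_ (Nat.le_mul_of_pos_right _ (hpos (n + 1)))
        exact Nat.pow_le_pow_right two_pos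
          (Nat.sub_le_sub_right (Nat.pow_le_pow_right two_pos (by omega)) 1)
  refine ⟨2 ^ (2 ^ N - 1), Nat.one_le_two_pow, fun n _ => ?_⟩
  have hfin := (IsSplittingField.algEquiv (iterField (AlgebraicClosure (RatFunc k)) Φ n)
    (iterComp Φ n)).toLinearEquiv.finrank_eq
  have := hbound n
  rw [hfin] at this
  exact this
end

section
/- Let k be a field of characteristic zero, K = k(t), and let γ, c ∈ k[t] with φ(x) = (x−γ)² + c. Assume φ is stable, post-critically infinite, and h(γ) ≠ h(c). Then for every n ≥ 17 the extension K_n/K_{n−1} is maximal, i.e. the splitting field of φ^n over K_{n−1} has degree 2^(2^(n−1)) over K_{n−1}. -/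
open Polynomial

/-- The quadratic map `a ↦ (a - γ)² + c` on a commutative ring. -/
def quadMap {R : Type*} [CommRing R] (γ c a : R) : R := (a - γ) ^ 2 + c

theorem map_quadMap_iterate {R S : Type*} [CommRing R] [CommRing S] (f : R →+* S) (γ c a : R)
    (n : ℕ) : f ((quadMap γ c)^[n] a) = (quadMap (f γ) (f c))^[n] (f a) :=
  (show Function.Semiconj f (quadMap γ c) (quadMap (f γ) (f c)) from
    fun x => by simp [quadMap]).iterate_right n a

section PolynomialOrbit

variable {A : Type*} [Field A]

/-- If `a² + c = d y²` then `y` divides `a c' - 2 a' c`. -/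
theorem mul_eq_twistedWronskian_of_sq_add_eq_mul_sq {a c d y : A[X]}
    (h : a ^ 2 + c = d * y ^ 2) :
    y * (2 * d * (a * derivative y - derivative a * y) + a * y * derivative d) =
      a * derivative c - 2 * derivative a * c := by
  have h' := congrArg derivative h
  simp only [derivative_add, derivative_mul, derivative_sq, map_ofNat] at h'
  linear_combination (2 * derivative a) * h - a * h'

theorem natDegree_X_mul_derivative_le (p : A[X]) : (X * derivative p).natDegree ≤ p.natDegree := by
  rw [natDegree_le_iff_coeff_eq_zero]
  rintro (_ | m) hm
  · simp
  · rw [coeff_X_mul, coeff_derivative, coeff_eq_zero_of_natDegree_lt hm, zero_mul]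

theorem coeff_natDegree_X_mul_derivative (p : A[X]) :
    (X * derivative p).coeff p.natDegree = p.natDegree * p.leadingCoeff := by
  rw [leadingCoeff]
  rcases p.natDegree with _ | m
  · simp
  · rw [coeff_X_mul, coeff_derivative]; push_cast; ring

theorem natDegree_X_mul_twistedWronskian_le (a c : A[X]) :
    (X * (a * derivative c - 2 * derivative a * c)).natDegree ≤ a.natDegree + c.natDegree := by
  have h : X * (a * derivative c - 2 * derivative a * c) =
      a * (X * derivative c) - C 2 * ((X * derivative a) * c) := by
    rw [map_ofNat]; ring
  rw [h]
  refine (natDegree_sub_le _ _).trans (max_le ?_ ?_)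
  · exact natDegree_mul_le_of_le le_rfl (natDegree_X_mul_derivative_le c)
  · exact (natDegree_C_mul_le _ _).trans
      (natDegree_mul_le_of_le (natDegree_X_mul_derivative_le a) le_rfl)

theorem coeff_X_mul_twistedWronskian (a c : A[X]) :
    (X * (a * derivative c - 2 * derivative a * c)).coeff (a.natDegree + c.natDegree) =
      ((c.natDegree : A) - 2 * a.natDegree) * (a.leadingCoeff * c.leadingCoeff) := by
  have h : X * (a * derivative c - 2 * derivative a * c) =
      a * (X * derivative c) - C 2 * ((X * derivative a) * c) := by
    rw [map_ofNat]; ring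
  rw [h, coeff_sub, coeff_C_mul,
    coeff_mul_add_eq_of_natDegree_le le_rfl (natDegree_X_mul_derivative_le c),
    coeff_mul_add_eq_of_natDegree_le (natDegree_X_mul_derivative_le a) le_rfl,
    coeff_natDegree_X_mul_derivative, coeff_natDegree_X_mul_derivative, coeff_natDegree,
    coeff_natDegree]
  ring

theorem natDegree_sq_add_s1 {a c : A[X]} (h : c.natDegree < 2 * a.natDegree) :
    (a ^ 2 + c).natDegree = 2 * a.natDegree := by
  rw [natDegree_add_eq_left_of_natDegree_lt (by rwa [natDegree_pow]), natDegree_pow]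

theorem coeff_sq_add {a c : A[X]} (h : c.natDegree < 2 * a.natDegree) :
    (a ^ 2 + c).coeff (a.natDegree + a.natDegree) = a.leadingCoeff ^ 2 := by
  rw [coeff_add, coeff_eq_zero_of_natDegree_lt (p := c) (by omega), sq,
    coeff_mul_add_eq_of_natDegree_le le_rfl le_rfl, coeff_natDegree]
  ring

theorem sq_natDegree_sub_eq [CharZero A] {a b c : A[X]} (hc : c ≠ 0)
    (ha : c.natDegree < 2 * a.natDegree) (hb : c.natDegree < 2 * b.natDegree)
    (h : (a * derivative c - 2 * derivative a * c) ^ 2 * (b ^ 2 + c) =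
      (b * derivative c - 2 * derivative b * c) ^ 2 * (a ^ 2 + c)) :
    a.natDegree = b.natDegree ∨ a.natDegree + b.natDegree = c.natDegree := by
  have key : ∀ a b : A[X], c.natDegree < 2 * b.natDegree →
      ((X * (a * derivative c - 2 * derivative a * c)) ^ 2 * (b ^ 2 + c)).coeff
        (((a.natDegree + c.natDegree) + (a.natDegree + c.natDegree)) +
          (b.natDegree + b.natDegree)) =
      (((c.natDegree : A) - 2 * a.natDegree) * (a.leadingCoeff * c.leadingCoeff)) ^ 2 *
        b.leadingCoeff ^ 2 := by
    intro a b hb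
    have hW := natDegree_X_mul_twistedWronskian_le a c
    rw [coeff_mul_add_eq_of_natDegree_le
        ((natDegree_pow_le_of_le 2 hW).trans (by omega))
        (by rw [natDegree_sq_add_s1 hb]; omega), coeff_sq_add hb, sq (X * _),
      coeff_mul_add_eq_of_natDegree_le hW hW, coeff_X_mul_twistedWronskian]
    ring
  have e : (X * (a * derivative c - 2 * derivative a * c)) ^ 2 * (b ^ 2 + c) =
      (X * (b * derivative c - 2 * derivative b * c)) ^ 2 * (a ^ 2 + c) := by
    linear_combination X ^ 2 * h
  have h1 := key a b hb
  rw [e, show (((a.natDegree + c.natDegree) + (a.natDegree + c.natDegree)) +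
          (b.natDegree + b.natDegree)) = (((b.natDegree + c.natDegree) +
          (b.natDegree + c.natDegree)) + (a.natDegree + a.natDegree)) by omega, key b a ha] at h1
  have ha0 : a.leadingCoeff ≠ 0 := by
    rw [leadingCoeff_ne_zero]; rintro rfl; simp at ha
  have hb0 : b.leadingCoeff ≠ 0 := by
    rw [leadingCoeff_ne_zero]; rintro rfl; simp at hb
  have hc0 : c.leadingCoeff ≠ 0 := by rwa [leadingCoeff_ne_zero]
  have h2 : ((c.natDegree : A) - 2 * b.natDegree) ^ 2 =
      ((c.natDegree : A) - 2 * a.natDegree) ^ 2 := by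
    have hne : (a.leadingCoeff * b.leadingCoeff * c.leadingCoeff) ^ 2 ≠ 0 := by positivity
    apply mul_right_cancel₀ hne
    linear_combination h1
  rcases sq_eq_sq_iff_eq_or_eq_neg.mp h2 with h3 | h3
  · left
    have : (2 * a.natDegree : A) = 2 * b.natDegree := by linear_combination h3
    have : 2 * a.natDegree = 2 * b.natDegree := by exact_mod_cast this
    omega
  · right
    have : (2 * (a.natDegree + b.natDegree) : A) = 2 * c.natDegree := by linear_combination -h3
    have : 2 * (a.natDegree + b.natDegree) = 2 * c.natDegree := by exact_mod_cast this
    omega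

/-- A height bound for polynomial solutions of `(x² + f)² + c = d y²`. -/
theorem natDegree_le_of_sq_add_sq_eq [CharZero A] {f c d x y : A[X]} (hc : c ≠ 0)
    (hcf : c.natDegree ≤ f.natDegree) (hf : 0 < f.natDegree)
    (hx : f.natDegree < x.natDegree) (h : (x ^ 2 + f) ^ 2 + c = d * y ^ 2) :
    x.natDegree ≤ d.natDegree + 4 * f.natDegree := by
  set a := x ^ 2 + f with ha
  set N := 2 * d * (a * derivative y - derivative a * y) + a * y * derivative d with hN
  have hyN : y * N = a * derivative c - 2 * derivative a * c :=
    mul_eq_twistedWronskian_of_sq_add_eq_mul_sq h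
  have hda : a.natDegree = 2 * x.natDegree := natDegree_sq_add_s1 (by omega)
  have hb : (a ^ 2 + c).natDegree = 2 * a.natDegree := natDegree_sq_add_s1 (by omega)
  have hb0 : a ^ 2 + c ≠ 0 := by rintro h0; rw [h0, natDegree_zero] at hb; omega
  have hd0 : d ≠ 0 := by rintro rfl; exact hb0 (by simpa using h)
  have hy0 : y ≠ 0 := by rintro rfl; exact hb0 (by simpa using h)
  have hdeg : 2 * a.natDegree = d.natDegree + 2 * y.natDegree := by
    rw [← hb, h, natDegree_mul hd0 (pow_ne_zero 2 hy0), natDegree_pow]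
  have hdN : 2 * N.natDegree ≤ d.natDegree + 2 * c.natDegree := by
    rcases eq_or_ne N 0 with h0 | h0
    · simp [h0]
    have := natDegree_X_mul_twistedWronskian_le a c
    rw [← hyN, natDegree_X_mul (mul_ne_zero hy0 h0), natDegree_mul hy0 h0] at this
    omega
  set W := f * derivative c - 2 * derivative f * c with hW
  have hdW : W.natDegree ≤ f.natDegree + c.natDegree := by
    have h1 := natDegree_X_mul_twistedWronskian_le f c
    rw [← hW] at h1
    rcases eq_or_ne W 0 with h0 | h0
    · simp [h0]
    rw [natDegree_X_mul h0] at h1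
    omega
  by_contra! hlt
  have hdvd : x ∣ N ^ 2 * (f ^ 2 + c) - d * W ^ 2 := by
    have hy2 : x ∣ (f ^ 2 + c) - d * y ^ 2 :=
      ⟨-(x * (x ^ 2 + 2 * f)), by rw [← h, ha]; ring⟩
    have hyW : x ∣ y * N - W := by
      refine ⟨x * derivative c - 4 * derivative x * c, ?_⟩
      rw [hyN, hW, ha]
      simp only [derivative_add, derivative_sq, map_ofNat]
      ring
    have := (hy2.mul_left (N ^ 2)).add (hyW.mul_left (d * (y * N + W)))
    convert this using 1
    ring
  have hdiff : N ^ 2 * (f ^ 2 + c) - d * W ^ 2 = 0 := by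
    refine eq_zero_of_dvd_of_natDegree_lt hdvd (lt_of_le_of_lt ?_ hlt)
    refine (natDegree_sub_le _ _).trans (max_le ?_ ?_)
    · refine natDegree_mul_le.trans ?_
      rw [natDegree_sq_add_s1 (by omega), natDegree_pow]
      omega
    · refine natDegree_mul_le.trans ?_
      rw [natDegree_pow]
      omega
  have hfin : (f * derivative c - 2 * derivative f * c) ^ 2 * (a ^ 2 + c) =
      (a * derivative c - 2 * derivative a * c) ^ 2 * (f ^ 2 + c) := by
    rw [← hW, ← hyN]
    apply mul_left_cancel₀ hd0
    rw [h]
    linear_combination (-d * y ^ 2) * hdiff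
  rcases sq_natDegree_sub_eq hc (by omega) (by omega) hfin with h1 | h1 <;> omega

end PolynomialOrbit

section PrimitiveRoot

variable {A : Type*} [Field A]

open Classical in
/-- Over an algebraically closed field, a polynomial is a square times the product of the linear
factors of odd multiplicity. -/
theorem exists_eq_mul_sq_natDegree_eq_card_odd [IsAlgClosed A] {B : A[X]} :
    ∃ d y : A[X], B = d * y ^ 2 ∧
      d.natDegree = (B.roots.toFinset.filter fun α => Odd (B.rootMultiplicity α)).card := by
  obtain ⟨s, hs⟩ := IsAlgClosed.exists_pow_nat_eq B.leadingCoeff (n := 2) two_pos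
  refine ⟨∏ α ∈ B.roots.toFinset.filter fun α => Odd (B.rootMultiplicity α), (X - C α),
    C s * ∏ α ∈ B.roots.toFinset, (X - C α) ^ (B.rootMultiplicity α / 2), ?_, ?_⟩
  · conv_lhs => rw [(IsAlgClosed.splits B).eq_prod_roots, Finset.prod_multiset_map_count, ← hs]
    rw [Finset.prod_filter, mul_pow, ← Finset.prod_pow, mul_left_comm, ← Finset.prod_mul_distrib,
      C_pow]
    congr 1
    refine Finset.prod_congr rfl fun α _ => ?_
    rw [count_roots]
    split_ifs with h
    · obtain ⟨m, hm⟩ := h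
      rw [hm, ← pow_mul, ← pow_succ']
      congr 1
      omega
    · obtain ⟨m, hm⟩ := Nat.not_odd_iff_even.mp h
      rw [hm, one_mul, ← pow_mul]
      congr 1
      omega
  · rw [natDegree_prod_of_monic _ _ fun α _ => monic_X_sub_C α]
    simp

theorem natDegree_quadMap_iterate_le {γ c x : A[X]} {D : ℕ} (hγ : γ.natDegree ≤ D)
    (hc : c.natDegree ≤ D) (hx : x.natDegree ≤ D) (n : ℕ) :
    ((quadMap γ c)^[n] x).natDegree ≤ 2 ^ n * D := by
  induction n with
  | zero => simpa using hx
  | succ n ih =>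
    rw [Function.iterate_succ_apply', quadMap]
    have hD : D ≤ 2 ^ n * D := Nat.le_mul_of_pos_left D (by positivity)
    refine natDegree_add_le_of_degree_le (natDegree_pow_le_of_le 2
      ((natDegree_sub_le _ _).trans (max_le ih (hγ.trans hD))) |>.trans (le_of_eq (by ring))) ?_
    exact hc.trans (hD.trans (Nat.mul_le_mul_right _ (Nat.pow_le_pow_right two_pos n.le_succ)))

theorem natDegree_quadMap_iterate_sub {γ c : A[X]} (h : 0 < (c - γ).natDegree) (n : ℕ) :
    ((quadMap γ c)^[n + 1] γ - γ).natDegree = 2 ^ n * (c - γ).natDegree := by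
  induction n with
  | zero => simp [quadMap]
  | succ n ih =>
    rw [Function.iterate_succ_apply', quadMap, add_sub_assoc, natDegree_sq_add_s1, ih]
    · ring
    · rw [ih]
      have : 0 < 2 ^ n := by positivity
      nlinarith

open Classical in
/-- The critical orbit eventually acquires, at every step, a new root of odd multiplicity. -/
theorem exists_odd_rootMultiplicity_quadMap_iterate [CharZero A] [IsAlgClosed A] {γ c : A[X]}
    (hc : c ≠ 0) (hdeg : γ.natDegree ≠ c.natDegree)
    (h0 : ∀ i, 1 ≤ i → (quadMap γ c)^[i] 0 ≠ 0) {n : ℕ} (hn : 17 ≤ n) :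
    ∃ α : A, Odd (((quadMap γ c)^[n] γ).rootMultiplicity α) ∧
      ∀ j, 1 ≤ j → j < n → ((quadMap γ c)^[j] γ).eval α ≠ 0 := by
  set D := (c - γ).natDegree with hD
  have hDmax : D = max γ.natDegree c.natDegree := by
    rcases lt_or_gt_of_ne hdeg with h | h
    · rw [hD, natDegree_sub_eq_left_of_natDegree_lt h, max_eq_right h.le]
    · rw [hD, natDegree_sub_eq_right_of_natDegree_lt h, max_eq_left h.le]
  have hγD : γ.natDegree ≤ D := by omega
  have hcD : c.natDegree ≤ D := by omega
  have hD0 : 0 < D := by omega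
  have hb0 : ∀ j, 1 ≤ j → (quadMap γ c)^[j] γ ≠ 0 := by
    rintro (_ | _ | j) hj h
    · omega
    · exact hc (by simpa [quadMap] using h)
    · have := natDegree_quadMap_iterate_sub hD0 (j + 1)
      rw [h, zero_sub, natDegree_neg, ← hD, pow_succ] at this
      have : 0 < 2 ^ j := by positivity
      nlinarith
  by_contra! hcon
  set B := (quadMap γ c)^[n] γ with hB
  obtain ⟨d, y, hdy, hdcard⟩ := exists_eq_mul_sq_natDegree_eq_card_odd (B := B)
  set m := n / 2 with hm
  have hbound : d.natDegree ≤ 4 * 2 ^ m * D := by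
    set P := ∏ j ∈ Finset.Icc 1 m, ((quadMap γ c)^[j] γ * (quadMap γ c)^[j] 0) with hP
    have hP0 : P ≠ 0 := Finset.prod_ne_zero_iff.mpr fun j hj =>
      mul_ne_zero (hb0 j (Finset.mem_Icc.mp hj).1) (h0 j (Finset.mem_Icc.mp hj).1)
    have hPdeg : P.natDegree ≤ 4 * 2 ^ m * D := by
      refine (natDegree_prod_le _ _).trans ((Finset.sum_le_sum (g := fun j => 2 ^ j * (2 * D))
        fun j _ => natDegree_mul_le.trans ?_).trans ?_)
      · have h1 := natDegree_quadMap_iterate_le hγD hcD hγD j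
        have h2 := natDegree_quadMap_iterate_le hγD hcD (x := 0) (by simp) j
        linarith
      · rw [← Finset.sum_mul]
        have h1 : ∑ j ∈ Finset.Icc 1 m, 2 ^ j ≤ 2 ^ (m + 1) := by
          refine (Finset.sum_le_sum_of_subset (t := Finset.range (m + 1)) fun j hj => ?_).trans
            (Nat.geomSum_lt le_rfl (n := m + 1) fun j hj => Finset.mem_range.mp hj).le
          rw [Finset.mem_Icc] at hj
          rw [Finset.mem_range]
          omega
        calc _ ≤ 2 ^ (m + 1) * (2 * D) := Nat.mul_le_mul_right _ h1
          _ = _ := by ring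
    refine le_trans ?_ hPdeg
    rw [hdcard]
    refine (Finset.card_le_card (t := P.roots.toFinset) fun α hα => ?_).trans
      ((Multiset.toFinset_card_le _).trans (card_roots' P))
    rw [Finset.mem_filter, Multiset.mem_toFinset, mem_roots'] at hα
    obtain ⟨j, hj1, hjn, hj⟩ := hcon α hα.2
    rw [Multiset.mem_toFinset, mem_roots hP0, IsRoot.def, hP, eval_prod,
      Finset.prod_eq_zero_iff]
    have hspec : ∀ (i : ℕ) (x : A[X]), ((quadMap γ c)^[i] x).eval α =
        (quadMap (γ.eval α) (c.eval α))^[i] (x.eval α) :=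
      fun i x => map_quadMap_iterate (evalRingHom α) γ c x i
    rcases le_or_gt j m with hle | hgt
    · exact ⟨j, Finset.mem_Icc.mpr ⟨hj1, hle⟩, by rw [eval_mul, hj, zero_mul]⟩
    · refine ⟨n - j, Finset.mem_Icc.mpr ⟨by omega, by omega⟩, ?_⟩
      have hroot := hα.1.2
      rw [IsRoot.def, hB, hspec, show n = (n - j) + j by omega, Function.iterate_add_apply,
        ← hspec j, hj] at hroot
      rw [eval_mul, hspec _ 0, eval_zero, hroot, mul_zero]
  obtain ⟨l, rfl⟩ : ∃ l, n = l + 3 := ⟨n - 3, by omega⟩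
  have hsplit : (((quadMap γ c)^[l + 1] γ - γ) ^ 2 + (c - γ)) ^ 2 + c = d * y ^ 2 := by
    rw [← hdy, hB, Function.iterate_succ_apply' _ (l + 2), Function.iterate_succ_apply' _ (l + 1),
      quadMap, quadMap, add_sub_assoc]
  have hxdeg := natDegree_quadMap_iterate_sub hD0 l
  rw [← hD] at hxdeg
  have hpow : 2 ^ (m + 3) ≤ 2 ^ l := Nat.pow_le_pow_right two_pos (by omega)
  have hpow' : 2 ^ 8 ≤ 2 ^ m := Nat.pow_le_pow_right two_pos (by omega)
  rw [pow_add] at hpow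
  have hle := natDegree_le_of_sq_add_sq_eq hc hcD hD0 (by rw [hxdeg, ← hD]; nlinarith) hsplit
  rw [hxdeg, ← hD] at hle
  nlinarith

end PrimitiveRoot

section MultiQuadratic

open IntermediateField

/-- If `e i` is a nonsquare under some field embedding under which all other `e j` become squares,
then the square roots of the `e i` generate an extension of the largest possible degree. -/
theorem finrank_adjoin_image_sqrt {F E L ι : Type*} [Field F] [Field E] [Algebra F E] [Field L]
    {e : ι → F} {r : ι → E} (hr : ∀ i, r i ^ 2 = algebraMap F E (e i)) {τ : ι → F →+* L}
    (hτ : ∀ i, ¬ IsSquare (τ i (e i))) (hτ' : ∀ i j, j ≠ i → IsSquare (τ i (e j)))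
    (s : Finset ι) : Module.finrank F (adjoin F (r '' s)) = 2 ^ s.card := by
  classical
  induction s using Finset.induction_on with
  | empty => simp
  | insert i s his ih =>
    set M := adjoin F (r '' s) with hM
    have hroot : ∀ j, aeval (r j) (X ^ 2 - C (e j)) = 0 := fun j => by simp [hr]
    have hns : ∀ b : M, b ^ 2 ≠ algebraMap F M (e i) := by
      intro b hb
      algebraize [τ i]
      obtain ⟨σ⟩ : Nonempty (M →ₐ[F] L) := by
        refine nonempty_algHom_adjoin_of_splits ?_
        rintro _ ⟨j, hj, rfl⟩
        refine ⟨⟨X ^ 2 - C (e j), monic_X_pow_sub_C _ two_ne_zero, hroot j⟩, ?_⟩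
        obtain ⟨z, hz⟩ := hτ' i j (by rintro rfl; exact his hj)
        have hsplit : ((X ^ 2 - C (e j)).map (algebraMap F L)).Splits := by
          have : (X ^ 2 - C (e j)).map (algebraMap F L) = (X - C z) * (X - C (-z)) := by
            have hz' : algebraMap F L (e j) = z * z := hz
            simp only [Polynomial.map_sub, Polynomial.map_pow, map_X, map_C, hz', C_mul, C_neg]
            ring
          rw [this]
          exact (Splits.X_sub_C _).mul (Splits.X_sub_C _)
        exact hsplit.of_dvd ((monic_X_pow_sub_C _ two_ne_zero).map _).ne_zero
          (Polynomial.map_dvd _ (minpoly.dvd F _ (hroot j)))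
      refine hτ i ⟨σ b, ?_⟩
      rw [← sq, ← map_pow, hb, AlgHom.commutes]
      rfl
    have hmin : minpoly M (r i) = X ^ 2 - C (algebraMap F M (e i)) := by
      refine (minpoly.eq_of_irreducible_of_monic
        (X_pow_sub_C_irreducible_of_prime Nat.prime_two hns) ?_
        (monic_X_pow_sub_C _ two_ne_zero)).symm
      simp [hr, ← IsScalarTower.algebraMap_apply]
    have hint : IsIntegral M (r i) :=
      ⟨X ^ 2 - C (algebraMap F M (e i)), monic_X_pow_sub_C _ two_ne_zero, by
        rw [← aeval_def]; simp [hr, ← IsScalarTower.algebraMap_apply]⟩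
    have h2 : Module.finrank M (adjoin M {r i}) = 2 := by
      rw [adjoin.finrank hint, hmin, natDegree_X_pow_sub_C]
    have hadj : (adjoin M {r i}).restrictScalars F = adjoin F (r '' (insert i s : Finset ι)) := by
      rw [hM, adjoin_adjoin_left, Finset.coe_insert, Set.image_insert_eq, Set.union_singleton]
    rw [← hadj, Finset.card_insert_of_notMem his, pow_succ, ← ih, ← h2]
    exact (Module.finrank_mul_finrank F M (adjoin M {r i})).symm

end MultiQuadratic

section QuadIterate

variable {R S : Type*} [CommRing R] [CommRing S]

/-- The `n`-th iterate of `(X - γ)² + c` as a polynomial. -/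
noncomputable def quadIterate (γ c : R) (n : ℕ) : R[X] :=
  (fun p => p.comp ((X - C γ) ^ 2 + C c))^[n] X

theorem quadIterate_succ (γ c : R) (n : ℕ) :
    quadIterate γ c (n + 1) = (quadIterate γ c n).comp ((X - C γ) ^ 2 + C c) :=
  Function.iterate_succ_apply' _ n X

theorem eval_quadIterate (γ c x : R) (n : ℕ) :
    (quadIterate γ c n).eval x = (quadMap γ c)^[n] x := by
  induction n generalizing x with
  | zero => simp [quadIterate]
  | succ n ih => simp [quadIterate_succ, ih, quadMap]

theorem map_quadIterate (f : R →+* S) (γ c : R) (n : ℕ) :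
    (quadIterate γ c n).map f = quadIterate (f γ) (f c) n := by
  induction n with
  | zero => simp [quadIterate]
  | succ n ih => simp [quadIterate_succ, Polynomial.map_comp, ih]

variable [IsDomain R]

theorem natDegree_X_sub_C_sq_add_C (γ c : R) : ((X - C γ) ^ 2 + C c).natDegree = 2 := by
  rw [natDegree_add_C, natDegree_pow, natDegree_X_sub_C]

theorem monic_quadIterate (γ c : R) (n : ℕ) : (quadIterate γ c n).Monic := by
  induction n with
  | zero => exact monic_X
  | succ n ih =>
    rw [quadIterate_succ]
    refine ih.comp (((monic_X_sub_C γ).pow 2).add_of_left ?_) ?_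
    · rw [degree_pow, degree_X_sub_C]
      exact degree_C_le.trans_lt (by norm_num)
    · rw [natDegree_X_sub_C_sq_add_C]; norm_num

theorem natDegree_quadIterate (γ c : R) (n : ℕ) : (quadIterate γ c n).natDegree = 2 ^ n := by
  induction n with
  | zero => simp [quadIterate]
  | succ n ih => rw [quadIterate_succ, natDegree_comp, ih, natDegree_X_sub_C_sq_add_C, pow_succ]

/-- A multiple root of an iterate forces the critical orbit through zero. -/
theorem eval_derivative_quadIterate_ne_zero [CharZero R] {γ c : R} {n : ℕ}
    (h : ∀ j, 1 ≤ j → j ≤ n → (quadMap γ c)^[j] γ ≠ 0) {x : R}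
    (hx : (quadMap γ c)^[n] x = 0) : (derivative (quadIterate γ c n)).eval x ≠ 0 := by
  induction n generalizing x with
  | zero => simp [quadIterate]
  | succ n ih =>
    have hxγ : x - γ ≠ 0 := by
      intro h0
      rw [sub_eq_zero.mp h0] at hx
      exact h (n + 1) (by omega) le_rfl hx
    rw [quadIterate_succ, derivative_comp, eval_mul, eval_comp]
    refine mul_ne_zero (by simpa [derivative_sq] using hxγ) ?_
    have := ih (fun j h1 h2 => h j h1 (by omega)) (x := quadMap γ c x) hx
    simpa [quadMap] using this

end QuadIterate

section PowerSeriesSplitting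

variable {A : Type*} [Field A]

theorem exists_root_constantCoeff_eq {γ c : PowerSeries A} {n : ℕ}
    (hs : (quadIterate γ c n).Splits) (h0 : PowerSeries.constantCoeff ((quadMap γ c)^[n + 1] γ) = 0) :
    ∃ β ∈ (quadIterate γ c n).roots, PowerSeries.constantCoeff β = PowerSeries.constantCoeff c := by
  have h1 := hs.eval_eq_prod_roots_of_monic (monic_quadIterate γ c n) c
  rw [eval_quadIterate] at h1
  rw [Function.iterate_succ_apply, show quadMap γ c γ = c by simp [quadMap], h1,
    map_multiset_prod, Multiset.prod_eq_zero_iff, Multiset.map_map] at h0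
  obtain ⟨β, hβ, hβ0⟩ := Multiset.mem_map.mp h0
  refine ⟨β, hβ, ?_⟩
  rw [Function.comp_apply, map_sub, sub_eq_zero] at hβ0
  exact hβ0.symm

theorem constantCoeff_quadMap_ne_zero_of_root {γ c β : PowerSeries A} {n : ℕ}
    (h0 : PowerSeries.constantCoeff ((quadMap γ c)^[n + 1] γ) ≠ 0)
    (hβ : (quadIterate γ c n).IsRoot β) : PowerSeries.constantCoeff (β - c) ≠ 0 := by
  intro h
  apply h0
  have h1 : PowerSeries.constantCoeff c = PowerSeries.constantCoeff β := by
    rw [map_sub, sub_eq_zero] at h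
    exact h.symm
  rw [IsRoot.def, eval_quadIterate] at hβ
  rw [Function.iterate_succ_apply, show quadMap γ c γ = c by simp [quadMap],
    map_quadMap_iterate _ _ _ c, congrArg (quadMap _ _)^[n] h1, ← map_quadMap_iterate, hβ, map_zero]

variable [CharZero A] [IsAlgClosed A]

theorem isSquare_of_constantCoeff_ne_zero {u : PowerSeries A}
    (hu : PowerSeries.constantCoeff u ≠ 0) : IsSquare u := by
  obtain ⟨s, hs⟩ := IsAlgClosed.exists_pow_nat_eq (PowerSeries.constantCoeff u) (n := 2) two_pos
  have hs0 : s ≠ 0 := by rintro rfl; exact hu (by simpa using hs.symm)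
  obtain ⟨a, ha, -⟩ := HenselianRing.is_henselian (I := Ideal.span {(PowerSeries.X : PowerSeries A)})
    (X ^ 2 - C u) (monic_X_pow_sub_C _ two_ne_zero) (PowerSeries.C s) (by
      rw [Ideal.mem_span_singleton, PowerSeries.X_dvd_iff]
      simp [hs]) (by
      refine IsUnit.map _ ?_
      rw [PowerSeries.isUnit_iff_constantCoeff]
      simp only [derivative_sub, derivative_sq, derivative_C, sub_zero, derivative_X, mul_one,
        eval_mul, eval_ofNat, eval_X, map_mul, map_ofNat, PowerSeries.constantCoeff_C, isUnit_iff_ne_zero]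
      exact mul_ne_zero two_ne_zero hs0)
  refine ⟨a, ?_⟩
  have : a ^ 2 - u = 0 := by simpa using ha
  rw [← sq]
  exact (sub_eq_zero.mp this).symm

theorem splits_quadIterate {γ c : PowerSeries A} {n : ℕ}
    (h : ∀ j, 1 ≤ j → j ≤ n → PowerSeries.constantCoeff ((quadMap γ c)^[j] γ) ≠ 0) :
    (quadIterate γ c n).Splits := by
  induction n with
  | zero => exact Splits.X
  | succ n ih =>
    have hs := ih fun j h1 h2 => h j h1 (by omega)
    rw [quadIterate_succ, hs.eq_prod_roots_of_monic (monic_quadIterate γ c n), multiset_prod_comp,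
      Multiset.map_map]
    refine Splits.multisetProd fun f hf => ?_
    obtain ⟨β, hβ, rfl⟩ := Multiset.mem_map.mp hf
    obtain ⟨r, hr⟩ := isSquare_of_constantCoeff_ne_zero
      (constantCoeff_quadMap_ne_zero_of_root (h (n + 1) (by omega) le_rfl) (mem_roots'.mp hβ).2)
    have : ((X - C β).comp ((X - C γ) ^ 2 + C c) : (PowerSeries A)[X]) =
        (X - C (γ + r)) * (X - C (γ - r)) := by
      have hr' : C β = C c + C r * C r := by rw [← C_mul, ← hr, ← C_add]; congr 1; ring
      rw [sub_comp, X_comp, C_comp, hr', C_add, C_sub]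
      ring
    rw [Function.comp_apply, this]
    exact (Splits.X_sub_C _).mul (Splits.X_sub_C _)

/-- If the critical value of level `n + 1` has odd order while the earlier ones are units, then
exactly one of the `β - c`, with `β` a root of the `n`-th iterate, is a nonsquare. -/
theorem exists_unique_root_not_isSquare {γ c u : PowerSeries A} {n e : ℕ}
    (h : ∀ j, 1 ≤ j → j ≤ n → PowerSeries.constantCoeff ((quadMap γ c)^[j] γ) ≠ 0)
    (he : Odd e) (hu : PowerSeries.constantCoeff u ≠ 0)
    (hB : (quadMap γ c)^[n + 1] γ = PowerSeries.X ^ e * u) :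
    ∃ β₀ ∈ (quadIterate γ c n).roots, ¬ IsSquare (β₀ - c) ∧
      ∀ β ∈ (quadIterate γ c n).roots, β ≠ β₀ → IsSquare (β - c) := by
  have he0 : e ≠ 0 := by rintro rfl; simp at he
  obtain ⟨β₀, hβ₀, hβ₀c⟩ := exists_root_constantCoeff_eq (splits_quadIterate h)
    (by rw [hB]; simp [he0])
  obtain ⟨g, hg⟩ := dvd_iff_isRoot.mpr (mem_roots'.mp hβ₀).2
  have hc0 : (quadMap γ c)^[n] c = (quadMap γ c)^[n + 1] γ := by
    rw [Function.iterate_succ_apply, show quadMap γ c γ = c by simp [quadMap]]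
  have hder := eval_derivative_quadIterate_ne_zero (γ := PowerSeries.constantCoeff γ) (c := PowerSeries.constantCoeff c)
    (n := n) (x := PowerSeries.constantCoeff c) (by simpa only [map_quadMap_iterate] using h)
    (by rw [← map_quadMap_iterate, hc0, hB]; simp [he0])
  rw [← map_quadIterate, hg] at hder
  have hgc : (g.map PowerSeries.constantCoeff).eval (PowerSeries.constantCoeff c) ≠ 0 := by
    simpa [derivative_mul, hβ₀c] using hder
  refine ⟨β₀, hβ₀, ?_, fun β hβ hne => ?_⟩
  · rintro ⟨z, hz⟩
    have hgu : PowerSeries.constantCoeff (g.eval c) ≠ 0 := by rwa [eval_map_apply] at hgc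
    have hprod : -(z * z) * g.eval c = PowerSeries.X ^ e * u := by
      rw [← hB, ← hc0, ← eval_quadIterate, hg, ← hz]
      simp
    have hord := congrArg PowerSeries.order hprod
    have hunit : ∀ v : PowerSeries A, PowerSeries.constantCoeff v ≠ 0 → v.order = 0 := fun v hv =>
      PowerSeries.order_zero_of_unit (PowerSeries.isUnit_iff_constantCoeff.mpr
        (isUnit_iff_ne_zero.mpr hv))
    rw [PowerSeries.order_mul, PowerSeries.order_mul, PowerSeries.order_neg,
      PowerSeries.order_mul, hunit _ hgu, hunit _ hu, PowerSeries.order_X_pow, add_zero,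
      add_zero] at hord
    induction hz' : z.order using ENat.recTopCoe with
    | top =>
      rw [hz', top_add] at hord
      exact ENat.top_ne_natCast e hord
    | coe m =>
      rw [hz'] at hord
      exact Nat.not_even_iff_odd.mpr he ⟨m, by exact_mod_cast hord.symm⟩
  · refine isSquare_of_constantCoeff_ne_zero fun hβc => hgc ?_
    have hβr : (quadIterate γ c n).eval β = 0 := (mem_roots'.mp hβ).2
    rw [hg, eval_mul, eval_sub, eval_X, eval_C, mul_eq_zero, or_iff_right (sub_ne_zero.mpr hne)]
      at hβr
    have : PowerSeries.constantCoeff c = PowerSeries.constantCoeff β := by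
      rw [map_sub, sub_eq_zero] at hβc
      exact hβc.symm
    rw [this, eval_map_apply, hβr, map_zero]

end PowerSeriesSplitting

theorem finrank_splittingField_quadIterate_succ {K L : Type*} [Field K] [CharZero K] [Field L]
    [Algebra K L] {γ c : K} {n : ℕ} (hirr : Irreducible (quadIterate γ c n))
    (hs : ((quadIterate γ c n).map (algebraMap K L)).Splits) {β₀ : L}
    (hβ₀ : ((quadIterate γ c n).map (algebraMap K L)).IsRoot β₀)
    (hns : ¬ IsSquare (β₀ - algebraMap K L c))
    (hsq : ∀ β, ((quadIterate γ c n).map (algebraMap K L)).IsRoot β → β ≠ β₀ →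
      IsSquare (β - algebraMap K L c)) :
    Module.finrank (quadIterate γ c n).SplittingField
      ((quadIterate γ c (n + 1)).map
        (algebraMap K (quadIterate γ c n).SplittingField)).SplittingField = 2 ^ 2 ^ n := by
  set P := quadIterate γ c n with hP
  set F := P.SplittingField
  set Q := (quadIterate γ c (n + 1)).map (algebraMap K F) with hQ
  set E := Q.SplittingField
  have hP0 : P ≠ 0 := (monic_quadIterate γ c n).ne_zero
  have hFs : (P.map (algebraMap K F)).Splits := SplittingField.splits P
  let ι₀ : F →ₐ[K] L := SplittingField.lift P hs
  have hroot : ∀ i : P.rootSet F, aeval (i : F) P = 0 := fun i => aeval_eq_zero_of_mem_rootSet i.2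
  have hmapL : ∀ x : F, aeval x P = 0 → (P.map (algebraMap K L)).IsRoot (ι₀ x) := fun x hx => by
    rw [IsRoot.def, eval_map_algebraMap, aeval_algHom_apply, hx, map_zero]
  obtain ⟨β₁, hβ₁⟩ : β₀ ∈ (ι₀ : F →+* L).range := by
    refine hFs.mem_range_of_isRoot (map_ne_zero hP0) ?_
    rw [Polynomial.map_map, AlgHom.comp_algebraMap]
    exact hβ₀
  have hβ₁' : ι₀ β₁ = β₀ := hβ₁
  have hβ₁P : aeval β₁ P = 0 := by
    apply (ι₀ : F →+* L).injective
    rw [map_zero, AlgHom.coe_toRingHom, ← aeval_algHom_apply, hβ₁', ← eval_map_algebraMap]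
    exact hβ₀
  have htrans : ∀ i : P.rootSet F, ∃ σ : Gal(F/K), σ i = β₁ := by
    intro i
    have : Normal K F := Normal.of_isSplittingField P
    refine isConjRoot_iff_exists_algEquiv.mp ?_
    rw [IsConjRoot, ← minpoly.eq_of_irreducible_of_monic hirr hβ₁P (monic_quadIterate γ c n),
      ← minpoly.eq_of_irreducible_of_monic hirr (hroot i) (monic_quadIterate γ c n)]
  choose σ hσ using htrans
  have hsqrt : ∀ i : P.rootSet F, ∃ z : E, z ^ 2 = algebraMap F E (i - algebraMap K F c) := by
    intro i
    have hdvd : (X - C (algebraMap K F γ)) ^ 2 + C (algebraMap K F c) - C (i : F) ∣ Q := by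
      have h1 : X - C (i : F) ∣ P.map (algebraMap K F) := by
        rw [dvd_iff_isRoot, IsRoot.def, eval_map_algebraMap, hroot]
      obtain ⟨g, hg⟩ := h1
      refine ⟨g.comp ((X - C (algebraMap K F γ)) ^ 2 + C (algebraMap K F c)), ?_⟩
      rw [hQ, quadIterate_succ, ← hP, Polynomial.map_comp, hg, mul_comp]
      simp
    have hsp := (SplittingField.splits Q).of_dvd
      (map_ne_zero ((monic_quadIterate γ c (n + 1)).map _).ne_zero)
      (Polynomial.map_dvd (algebraMap F E) hdvd)
    obtain ⟨x, hx⟩ := hsp.exists_eval_eq_zero (by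
      rw [degree_map, add_sub_assoc, ← C_sub]
      refine fun h => absurd (natDegree_eq_of_degree_eq_some h) ?_
      rw [natDegree_X_sub_C_sq_add_C]
      norm_num)
    refine ⟨x - algebraMap F E (algebraMap K F γ), ?_⟩
    simp only [Polynomial.map_sub, Polynomial.map_add, Polynomial.map_pow, map_X, map_C, eval_sub,
      eval_add, eval_pow, eval_X, eval_C] at hx
    rw [map_sub]
    linear_combination hx
  choose r hr using hsqrt
  have htop : IntermediateField.adjoin F (r '' (Finset.univ : Finset (P.rootSet F))) = ⊤ := by
    rw [← IntermediateField.toSubalgebra_inj, IntermediateField.top_toSubalgebra, eq_top_iff,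
      ← SplittingField.adjoin_rootSet Q, Algebra.adjoin_le_iff]
    intro x hx
    have hxQ : (P.map (algebraMap K E)).IsRoot
        (quadMap (algebraMap K E γ) (algebraMap K E c) x) := by
      have h1 := aeval_eq_zero_of_mem_rootSet hx
      have hQE : Q.map (algebraMap F E) =
          quadIterate (algebraMap K E γ) (algebraMap K E c) (n + 1) :=
        (Polynomial.map_map _ _ _).trans
          (by rw [← IsScalarTower.algebraMap_eq, map_quadIterate])
      rw [← eval_map_algebraMap, hQE, eval_quadIterate, Function.iterate_succ_apply] at h1
      have hPE : P.map (algebraMap K E) =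
          quadIterate (algebraMap K E γ) (algebraMap K E c) n := map_quadIterate _ γ c n
      rw [IsRoot.def, hPE, eval_quadIterate, h1]
    obtain ⟨β, hβ⟩ : quadMap (algebraMap K E γ) (algebraMap K E c) x ∈ (algebraMap F E).range := by
      refine hFs.mem_range_of_isRoot (map_ne_zero hP0) ?_
      rw [Polynomial.map_map, ← IsScalarTower.algebraMap_eq]
      exact hxQ
    have hβP : β ∈ P.rootSet F := by
      rw [mem_rootSet]
      refine ⟨hP0, (algebraMap F E).injective ?_⟩
      rw [map_zero, ← aeval_algebraMap_apply, hβ, ← eval_map_algebraMap]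
      exact hxQ
    have hsq : (x - algebraMap K E γ) ^ 2 = r ⟨β, hβP⟩ ^ 2 := by
      rw [hr, map_sub, hβ, quadMap, ← IsScalarTower.algebraMap_apply]
      ring
    have hrmem : r ⟨β, hβP⟩ ∈ IntermediateField.adjoin F
        (r '' (Finset.univ : Finset (P.rootSet F))) :=
      IntermediateField.subset_adjoin _ _ ⟨_, by simp, rfl⟩
    have hγmem : algebraMap K E γ ∈ IntermediateField.adjoin F
        (r '' (Finset.univ : Finset (P.rootSet F))) := by
      rw [IsScalarTower.algebraMap_apply K F E]
      exact IntermediateField.algebraMap_mem _ _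
    rcases sq_eq_sq_iff_eq_or_eq_neg.mp hsq with h | h
    · rw [sub_eq_iff_eq_add.mp h]
      exact add_mem hrmem hγmem
    · rw [sub_eq_iff_eq_add.mp h]
      exact add_mem (neg_mem hrmem) hγmem
  have hσc : ∀ (i : P.rootSet F) (x : F), ι₀ (σ i (x - algebraMap K F c)) =
      ι₀ (σ i x) - algebraMap K L c := fun i x => by simp
  have hfin := finrank_adjoin_image_sqrt hr
    (τ := fun i => (ι₀ : F →+* L).comp ((σ i : F ≃ₐ[K] F) : F →+* F))
    (fun i => by
      change ¬ IsSquare (ι₀ (σ i (i - algebraMap K F c)))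
      rwa [hσc, hσ, hβ₁'])
    (fun i j hij => by
      change IsSquare (ι₀ (σ i (j - algebraMap K F c)))
      rw [hσc]
      refine hsq _ (hmapL _ ?_) fun h => hij ?_
      · rw [aeval_algHom_apply, hroot, map_zero]
      · rw [← hβ₁', ← hσ i] at h
        exact Subtype.ext ((σ i).injective ((ι₀ : F →+* L).injective h)))
    Finset.univ
  have hPdeg : P.natDegree = 2 ^ n := natDegree_quadIterate γ c n
  rw [htop, IntermediateField.finrank_top', Finset.card_univ,
    card_rootSet_eq_natDegree hirr.separable hFs, hPdeg] at hfin
  exact hfin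

theorem isSquare_of_isSquare_algebraMap {R L : Type*} [CommRing R] [IsDomain R]
    [IsIntegrallyClosed R] [Field L] [Algebra R L] [IsFractionRing R L] {x : R}
    (h : IsSquare (algebraMap R L x)) : IsSquare x := by
  obtain ⟨z, hz⟩ := h
  obtain ⟨y, rfl⟩ := IsIntegrallyClosed.exists_algebraMap_eq_of_isIntegral_pow (R := R) (x := z)
    two_pos (by rw [sq, ← hz]; exact isIntegral_algebraMap)
  exact ⟨y, IsFractionRing.injective R L (by rw [hz, map_mul])⟩

/-- Expansion of polynomials over `k` as power series around a point of an extension field. -/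
noncomputable def taylorPowerSeries {k A : Type*} [Field k] [Field A] [Algebra k A] (α : A) :
    k[X] →+* PowerSeries A :=
  coeToPowerSeries.ringHom.comp
    ((taylorAlgHom α : A[X] →+* A[X]).comp (mapRingHom (algebraMap k A)))

section Taylor

variable {k A : Type*} [Field k] [Field A] [Algebra k A] (α : A)

theorem taylorPowerSeries_apply (f : k[X]) :
    taylorPowerSeries α f = (taylor α (f.map (algebraMap k A)) : PowerSeries A) := rfl

theorem taylorPowerSeries_injective :
    Function.Injective (taylorPowerSeries α : k[X] →+* PowerSeries A) := fun _ _ h =>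
  map_injective _ (algebraMap k A).injective (taylor_injective α (coe_injective A h))

theorem constantCoeff_taylorPowerSeries (f : k[X]) :
    PowerSeries.constantCoeff (taylorPowerSeries α f) = (f.map (algebraMap k A)).eval α := by
  rw [taylorPowerSeries_apply, ← PowerSeries.coeff_zero_eq_constantCoeff_apply, coeff_coe,
    taylor_coeff_zero]

theorem exists_taylorPowerSeries_eq_X_pow_mul {f : k[X]} (hf : f ≠ 0) :
    ∃ u : PowerSeries A, PowerSeries.constantCoeff u ≠ 0 ∧ taylorPowerSeries α f =
      PowerSeries.X ^ ((f.map (algebraMap k A)).rootMultiplicity α) * u := by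
  obtain ⟨q, hq, hndvd⟩ := exists_eq_pow_rootMultiplicity_mul_and_not_dvd
    (f.map (algebraMap k A)) (map_ne_zero hf) α
  refine ⟨(taylor α q : PowerSeries A), ?_, ?_⟩
  · rw [← PowerSeries.coeff_zero_eq_constantCoeff_apply, coeff_coe, taylor_coeff_zero]
    rwa [dvd_iff_isRoot] at hndvd
  · rw [taylorPowerSeries_apply]
    conv_lhs => rw [hq]
    simp [taylor_mul, taylor_pow]

end Taylor

/-- Theorem 1 part 1 (maximality): if `φ = (x-γ)²+c` over `K = k(t)` is stable,
post-critically infinite and `h(γ) ≠ h(c)`, then `K_n/K_{n-1}` is maximal for all `n ≥ 17`. -/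
theorem maximal_extensions_of_ne_height (k : Type*) [Field k] [CharZero k] (γ c : Polynomial k)
    (φ : Polynomial (RatFunc k))
    (hφ : φ = (X - C (algebraMap (Polynomial k) (RatFunc k) γ)) ^ 2
            + C (algebraMap (Polynomial k) (RatFunc k) c))
    (hstable : ∀ n : ℕ, 1 ≤ n →
      Irreducible ((fun p => p.comp φ)^[n] (X : Polynomial (RatFunc k))))
    (hpci : Set.Infinite
      {x : Polynomial k | ∃ n : ℕ, 1 ≤ n ∧ (fun a => (a - γ) ^ 2 + c)^[n] γ = x})
    (hdeg : γ.natDegree ≠ c.natDegree) :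
    ∀ n : ℕ, 17 ≤ n →
      Module.finrank
        (Polynomial.SplittingField ((fun p => p.comp φ)^[n - 1] (X : Polynomial (RatFunc k))))
        (Polynomial.SplittingField
          (((fun p => p.comp φ)^[n] (X : Polynomial (RatFunc k))).map
            (algebraMap (RatFunc k)
              (Polynomial.SplittingField
                ((fun p => p.comp φ)^[n - 1] (X : Polynomial (RatFunc k)))))))
      = 2 ^ 2 ^ (n - 1) := by
  intro n hn
  obtain ⟨n, rfl⟩ : ∃ m, n = m + 1 := ⟨n - 1, by omega⟩
  subst hφ
  rw [Nat.add_sub_cancel]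
  set γ' := algebraMap k[X] (RatFunc k) γ
  set c' := algebraMap k[X] (RatFunc k) c
  have hirr : ∀ m, 1 ≤ m → Irreducible (quadIterate γ' c' m) := hstable
  change Module.finrank (quadIterate γ' c' n).SplittingField
    ((quadIterate γ' c' (n + 1)).map
      (algebraMap (RatFunc k) (quadIterate γ' c' n).SplittingField)).SplittingField = 2 ^ 2 ^ n
  have hnoroot : ∀ m, 1 ≤ m → ∀ x : k[X], (quadMap γ c)^[m] x ≠ 0 := by
    intro m hm x hx
    have h1 : (quadIterate γ' c' m).IsRoot (algebraMap k[X] (RatFunc k) x) := by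
      rw [IsRoot.def, eval_quadIterate, ← map_quadMap_iterate, hx, map_zero]
    have h2 : (quadIterate γ' c' m).natDegree = 1 :=
      natDegree_eq_of_degree_eq_some (degree_eq_one_of_irreducible_of_root (hirr m hm) h1)
    rw [natDegree_quadIterate] at h2
    have : 2 ^ 1 ≤ 2 ^ m := Nat.pow_le_pow_right two_pos hm
    omega
  let A := AlgebraicClosure k
  let ρ : k[X] →+* A[X] := mapRingHom (algebraMap k A)
  have hρ : Function.Injective ρ := map_injective _ (algebraMap k A).injective
  obtain ⟨α, hodd, hunit⟩ := exists_odd_rootMultiplicity_quadMap_iterate (γ := ρ γ) (c := ρ c)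
    (fun h => hnoroot 1 le_rfl γ (hρ (by simpa [quadMap] using h)))
    (by simpa [ρ, natDegree_map] using hdeg)
    (fun i hi h => hnoroot i hi 0 (hρ (by rw [map_quadMap_iterate, map_zero, h]))) hn
  rw [← map_quadMap_iterate] at hodd
  let θ : k[X] →+* PowerSeries A := taylorPowerSeries α
  obtain ⟨u, hu, hθu⟩ := exists_taylorPowerSeries_eq_X_pow_mul α (hnoroot (n + 1) (by omega) γ)
  have hθunit : ∀ j, 1 ≤ j → j ≤ n →
      PowerSeries.constantCoeff ((quadMap (θ γ) (θ c))^[j] (θ γ)) ≠ 0 := by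
    intro j h1 h2
    rw [← map_quadMap_iterate, constantCoeff_taylorPowerSeries]
    have := hunit j h1 (by omega)
    rwa [← map_quadMap_iterate] at this
  have hθs := splits_quadIterate hθunit
  obtain ⟨β₀, hβ₀, hns, hsq⟩ := exists_unique_root_not_isSquare hθunit hodd hu
    (by rw [← map_quadMap_iterate]; exact hθu)
  let L := FractionRing (PowerSeries A)
  let κ : RatFunc k →+* L := IsFractionRing.lift (A := k[X])
    (g := (algebraMap (PowerSeries A) L).comp θ)
    ((IsFractionRing.injective (PowerSeries A) L).comp (taylorPowerSeries_injective α))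
  have hκ : ∀ f : k[X], κ (algebraMap k[X] (RatFunc k) f) = algebraMap (PowerSeries A) L (θ f) :=
    fun f => IsFractionRing.lift_algebraMap _ f
  algebraize [κ]
  have hmap : (quadIterate γ' c' n).map (algebraMap (RatFunc k) L) =
      (quadIterate (θ γ) (θ c) n).map (algebraMap (PowerSeries A) L) := by
    rw [map_quadIterate, map_quadIterate, ← hκ, ← hκ]
    rfl
  have hc' : algebraMap (RatFunc k) L c' = algebraMap (PowerSeries A) L (θ c) := hκ c
  refine finrank_splittingField_quadIterate_succ (L := L) (hirr n (by omega))
    (by rw [hmap]; exact hθs.map _) (β₀ := algebraMap (PowerSeries A) L β₀) ?_ ?_ ?_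
  · rw [hmap]
    exact (mem_roots'.mp hβ₀).2.map
  · rw [hc', ← map_sub]
    exact fun h => hns (isSquare_of_isSquare_algebraMap h)
  · intro β hβ hne
    rw [hmap, ← mem_roots ((monic_quadIterate _ _ _).map _).ne_zero,
      hθs.roots_map_of_injective (IsFractionRing.injective (PowerSeries A) L)] at hβ
    obtain ⟨b, hb, rfl⟩ := Multiset.mem_map.mp hβ
    rw [hc', ← map_sub]
    exact (hsq b hb fun h => hne (by rw [h])).map _
end
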